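/- arXiv:1701.01318 — 12 statements merged into one kernel-verified Lean document; each statement's English description precedes it below -/
import Mathlib

section
/- There exist a nonempty compact metrizable totally disconnected topological space X with a compatible metric d and a homeomorphism T : X → X such that: (i) T is expansive, i.e. there exists c > 0 such that for all x, y ∈ X, if d(T^n x, T^n y) ≤ c for every n ∈ ℤ then x = y; (ii) T has positive topological entropy (in the sense of Bowen–Dinaburg cover entropy, as in Mathlib's coverEntropy, the entropy of T on X is strictly positive); and (iii) T has no off-diagonal asymptotic pairs: for all x, y ∈ X, if for every ε > 0 the set {n ∈ ℤ : d(T^n x, T^n y) ≥ ε} is finite, then x = y. -/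
/-- A witness for Theorem 1.3: a nonempty compact metrizable totally disconnected space
together with an expansive homeomorphism of positive topological entropy having
no off-diagonal asymptotic pairs. -/
structure ExpansivePosEntropyNoAsympWitness where
  /-- The underlying space. -/
  X : Type
  /-- A compatible metric on `X`. -/
  [metricX : MetricSpace X]
  [compactX : CompactSpace X]
  [tdX : TotallyDisconnectedSpace X]
  nonemptyX : Nonempty X
  /-- The homeomorphism. -/
  T : X ≃ₜ X
  /-- `T` is expansive. -/
  expansive : ∃ c : ℝ, 0 < c ∧ ∀ x y : X,
    (∀ n : ℤ, dist ((T.toEquiv ^ n) x) ((T.toEquiv ^ n) y) ≤ c) → x = y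
  /-- `T` has positive topological entropy (Bowen–Dinaburg cover entropy). -/
  pos_entropy : 0 < Dynamics.coverEntropy (⇑T) Set.univ
  /-- `T` has no off-diagonal asymptotic pairs. -/
  no_offdiag_asymptotic : ∀ x y : X,
    (∀ ε : ℝ, 0 < ε → {n : ℤ | ε ≤ dist ((T.toEquiv ^ n) x) ((T.toEquiv ^ n) y)}.Finite) → x = y

namespace BlockSubshift

open Set Filter Topology

variable {A : Type*}

/-- The word of length `n` read in the bi-infinite sequence `x` from position `a` on. -/
def window (n : ℕ) (x : ℤ → A) (a : ℤ) : Fin n → A := fun i => x (a + i)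

/-- The `i`-th of the `r` consecutive blocks of length `n` of a word of length `r * n`. -/
def subblock {m r n : ℕ} (h : m = r * n) (w : Fin m → A) (i : Fin r) : Fin n → A :=
  fun j => w (Fin.cast h.symm (finProdFinEquiv (i, j)))

lemma subblock_window {m r n : ℕ} (h : m = r * n) (x : ℤ → A) (a : ℤ) (i : Fin r) :
    subblock h (window m x a) i = window n x (a + i * n) := by
  funext j
  simp only [subblock, window, Fin.val_cast, finProdFinEquiv_apply_val]
  congr 1
  push_cast
  ring

/-- The words of `V` are concatenations of words of `W`, the first of which is a marker that
occurs nowhere else, and two distinct words of `V` differ in at least two blocks. -/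
structure IsRefinement {m r n : ℕ} (h : m = r * n) (V : Finset (Fin m → A))
    (W : Finset (Fin n → A)) : Prop where
  subblock_mem : ∀ v ∈ V, ∀ i, subblock h v i ∈ W
  exists_marker : ∃ w, ∀ v ∈ V, ∀ i, subblock h v i = w ↔ (i : ℕ) = 0
  separated : ∀ u ∈ V, ∀ v ∈ V, u ≠ v →
    ∃ i j, i < j ∧ subblock h u i ≠ subblock h v i ∧ subblock h u j ≠ subblock h v j

lemma exists_pow_gt {q M : ℕ} (hq : 0 < q) (hM : q < M) : ∃ s : ℕ, q ^ (s + 2) + 1 < M ^ s := by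
  have hq' : (0 : ℝ) < q := by exact_mod_cast hq
  have h1 : (1 : ℝ) < M / q := by
    rw [one_lt_div hq']
    exact_mod_cast hM
  obtain ⟨s, hs⟩ := pow_unbounded_of_one_lt ((q : ℝ) ^ 2 + 1) h1
  refine ⟨s, ?_⟩
  rw [div_pow, lt_div_iff₀ (by positivity)] at hs
  have h2 : 1 ≤ q ^ s := Nat.one_le_pow _ _ hq
  have h3 : (q ^ 2 + 1) * q ^ s < M ^ s := by exact_mod_cast hs
  calc q ^ (s + 2) + 1 ≤ (q ^ 2 + 1) * q ^ s := by rw [pow_add]; nlinarith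
    _ < M ^ s := h3

/-- Appending the sum of its entries to a tuple gives a code of minimal distance two. -/
lemma exists_two_ne_snoc_sum {G : Type*} [AddCommGroup G] {s : ℕ} {f g : Fin s → G} (hfg : f ≠ g) :
    ∃ i j : Fin (s + 1), i < j ∧
      (Fin.snoc f (∑ a, f a) : Fin (s + 1) → G) i ≠ (Fin.snoc g (∑ a, g a) : Fin (s + 1) → G) i ∧
      (Fin.snoc f (∑ a, f a) : Fin (s + 1) → G) j ≠
        (Fin.snoc g (∑ a, g a) : Fin (s + 1) → G) j := by
  obtain ⟨a, ha⟩ := Function.ne_iff.1 hfg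
  by_cases hs : ∑ a, f a = ∑ a, g a
  · obtain ⟨b, hba, hb⟩ : ∃ b, b ≠ a ∧ f b ≠ g b := by
      by_contra! H
      apply ha
      rw [← Finset.add_sum_erase _ _ (Finset.mem_univ a),
        ← Finset.add_sum_erase _ g (Finset.mem_univ a),
        Finset.sum_congr rfl fun b hb => H b (Finset.ne_of_mem_erase hb)] at hs
      exact add_right_cancel hs
    rcases lt_or_gt_of_ne hba with h | h
    · exact ⟨b.castSucc, a.castSucc, by simpa using h, by simpa using hb, by simpa using ha⟩
    · exact ⟨a.castSucc, b.castSucc, by simpa using h, by simpa using ha, by simpa using hb⟩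
  · exact ⟨a.castSucc, Fin.last s, Fin.castSucc_lt_last a, by simpa using ha, by simpa using hs⟩

theorem exists_isRefinement {n : ℕ} (W : Finset (Fin n → A)) (hW : 2 ^ n + 1 < W.card) :
    ∃ (r : ℕ) (V : Finset (Fin (r * n) → A)), 0 < r ∧ 2 ^ (r * n) + 1 < V.card ∧
      IsRefinement rfl V W := by
  classical
  obtain ⟨m, hm⟩ : W.Nonempty := Finset.card_pos.1 (by lia)
  set M := (W.erase m).card with hM
  have hMW : M = W.card - 1 := Finset.card_erase_of_mem hm
  obtain ⟨s, hs⟩ := exists_pow_gt (q := 2 ^ n) (M := M) (by positivity) (by lia)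
  have : NeZero M := ⟨by lia⟩
  let e : ZMod M ≃ {w // w ∈ W.erase m} := Fintype.equivOfCardEq (by simp [ZMod.card, hM])
  let B : (Fin s → ZMod M) → Fin (s + 2) → Fin n → A := fun f =>
    Fin.cons m fun i => (e ((Fin.snoc f (∑ a, f a) : Fin (s + 1) → ZMod M) i) : Fin n → A)
  let Φ : (Fin s → ZMod M) → Fin ((s + 2) * n) → A := fun f t =>
    B f (finProdFinEquiv.symm t).1 (finProdFinEquiv.symm t).2
  have hΦ : ∀ f i, subblock rfl (Φ f) i = B f i := fun f i => by
    funext j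
    simp only [subblock, Φ, Fin.cast_eq_self, Equiv.symm_apply_apply]
  have hsep : ∀ f g, f ≠ g → ∃ i j, i < j ∧ B f i ≠ B g i ∧ B f j ≠ B g j := by
    intro f g hfg
    obtain ⟨i, j, hij, hi, hj⟩ := exists_two_ne_snoc_sum hfg
    refine ⟨i.succ, j.succ, by simpa using hij, ?_, ?_⟩
    · simpa [B, Subtype.val_inj] using hi
    · simpa [B, Subtype.val_inj] using hj
  have hinj : Function.Injective Φ := by
    intro f g hfg
    by_contra H
    obtain ⟨i, j, -, hi, -⟩ := hsep f g H
    exact hi (by rw [← hΦ, ← hΦ, hfg])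
  refine ⟨s + 2, Finset.univ.image Φ, by lia, ?_, ?_, ⟨m, ?_⟩, ?_⟩
  · rw [Finset.card_image_of_injective _ hinj]
    simpa [ZMod.card, ← pow_mul, mul_comm] using hs
  · simp only [Finset.mem_image, Finset.mem_univ, true_and, forall_exists_index,
      forall_apply_eq_imp_iff, hΦ]
    intro f i
    cases i using Fin.cases with
    | zero => simpa [B] using hm
    | succ i => exact Finset.mem_of_mem_erase (e _).2
  · simp only [Finset.mem_image, Finset.mem_univ, true_and, forall_exists_index,
      forall_apply_eq_imp_iff, hΦ]
    intro f i
    cases i using Fin.cases with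
    | zero => simp [B]
    | succ i => simpa [B] using Finset.ne_of_mem_erase (e _).2
  · simp only [Finset.mem_image, Finset.mem_univ, true_and, forall_exists_index,
      forall_apply_eq_imp_iff, hΦ]
    exact fun f g hfg => hsep f g fun h => hfg (h ▸ rfl)

/-- A set of more than `2 ^ len + 1` words of the positive length `len`. -/
structure BlockFamily (A : Type*) where
  len : ℕ
  len_pos : 0 < len
  words : Finset (Fin len → A)
  card_words : 2 ^ len + 1 < words.card

/-- `V` is obtained from `W` by concatenation as in `IsRefinement`. -/
def BlockFamily.Refines (V W : BlockFamily A) : Prop :=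
  ∃ (r : ℕ) (h : V.len = r * W.len), IsRefinement h V.words W.words

lemma exists_seq_refines :
    ∃ F : ℕ → BlockFamily (Fin 4), (F 0).len = 1 ∧ ∀ k, (F (k + 1)).Refines (F k) := by
  have step : ∀ W : BlockFamily (Fin 4), ∃ V : BlockFamily (Fin 4), V.Refines W := fun W => by
    obtain ⟨r, V, hr, hV, h⟩ := exists_isRefinement W.words W.card_words
    exact ⟨⟨r * W.len, Nat.mul_pos hr W.len_pos, V, hV⟩, r, rfl, h⟩
  choose f hf using step
  refine ⟨fun k => f^[k] ⟨1, one_pos, Finset.univ, by simp [Finset.card_univ]⟩, rfl, fun k => ?_⟩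
  simp only [Function.iterate_succ_apply']
  exact hf _

namespace BlockFamily

/-- `x` is a concatenation of words of `W`, one of which starts at position `p`. -/
def IsConcat (W : BlockFamily A) (p : ℤ) (x : ℤ → A) : Prop :=
  ∀ i : ℤ, window W.len x (p + i * W.len) ∈ W.words

/-- The bi-infinite concatenations of words of `W`. -/
def concatSet (W : BlockFamily A) : Set (ℤ → A) := {x | ∃ p, W.IsConcat p x}

variable {V W : BlockFamily A} {x y : ℤ → A} {p q : ℤ}

lemma IsConcat.add_mul (h : W.IsConcat p x) (j : ℤ) : W.IsConcat (p + j * W.len) x := fun i => by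
  have := h (j + i)
  rwa [_root_.add_mul, ← add_assoc] at this

lemma IsConcat.shift (h : W.IsConcat p x) (a : ℤ) :
    W.IsConcat (p - a) fun i => x (i + a) := fun i => by
  convert h i using 1
  funext j
  simp only [window]
  congr 1
  ring

lemma shift_mem_concatSet (h : x ∈ W.concatSet) (a : ℤ) : (fun i => x (i + a)) ∈ W.concatSet :=
  let ⟨_, hp⟩ := h
  ⟨_, hp.shift a⟩

lemma IsConcat.of_isRefinement {r : ℕ} {h : V.len = r * W.len}
    (hVW : IsRefinement h V.words W.words) (hx : V.IsConcat p x) : W.IsConcat p x := by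
  intro i
  have hr : 0 < r := Nat.pos_of_mul_pos_right (h ▸ V.len_pos)
  have hr' : (r : ℤ) ≠ 0 := by exact_mod_cast hr.ne'
  have hlt : (i % r).toNat < r := by
    have := Int.emod_lt_of_pos i (b := r) (by exact_mod_cast hr)
    lia
  have := hVW.subblock_mem _ (hx (i / r)) ⟨(i % r).toNat, hlt⟩
  rw [subblock_window] at this
  convert this using 2
  have h1 : (((i % r).toNat : ℕ) : ℤ) = i % r := Int.toNat_of_nonneg (Int.emod_nonneg _ hr')
  have h2 := Int.mul_ediv_add_emod i r
  simp only [h1, h]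
  push_cast
  linear_combination (-(W.len : ℤ)) * h2

/-- The marker of a refinement occurs exactly at the beginning of the longer blocks. -/
lemma IsConcat.window_eq_marker_iff {r : ℕ} {h : V.len = r * W.len} {w : Fin W.len → A}
    (hw : ∀ v ∈ V.words, ∀ i, subblock h v i = w ↔ (i : ℕ) = 0) (hx : V.IsConcat p x) (i : ℤ) :
    window W.len x (p + i * W.len) = w ↔ (r : ℤ) ∣ i := by
  have hr : 0 < r := Nat.pos_of_mul_pos_right (h ▸ V.len_pos)
  have hr' : (r : ℤ) ≠ 0 := by exact_mod_cast hr.ne'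
  have hlt : (i % r).toNat < r := by
    have := Int.emod_lt_of_pos i (b := r) (by exact_mod_cast hr)
    lia
  have := hw _ (hx (i / r)) ⟨(i % r).toNat, hlt⟩
  have h1 : (((i % r).toNat : ℕ) : ℤ) = i % r := Int.toNat_of_nonneg (Int.emod_nonneg _ hr')
  have h2 := Int.mul_ediv_add_emod i r
  have h3 : p + i / r * V.len + (i % r) * W.len = p + i * W.len := by
    rw [h]
    push_cast
    linear_combination (W.len : ℤ) * h2
  rw [subblock_window, h1, h3] at this
  rw [this, Int.dvd_iff_emod_eq_zero]
  lia

lemma Refines.concatSet_subset (h : V.Refines W) : V.concatSet ⊆ W.concatSet := by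
  obtain ⟨r, h, hVW⟩ := h
  exact fun x ⟨p, hp⟩ => ⟨p, hp.of_isRefinement hVW⟩

variable {F : ℕ → BlockFamily A}

/-- The positions of the blocks of each level are determined by any right half of a sequence. -/
lemma exists_eq_add_mul_len (h0 : (F 0).len = 1) (hF : ∀ k, (F (k + 1)).Refines (F k)) {N : ℤ}
    (hxy : ∀ i, N ≤ i → x i = y i) (k : ℕ) :
    ∀ p q, (F k).IsConcat p x → (F k).IsConcat q y → ∃ j : ℤ, q = p + j * (F k).len := by
  induction k with
  | zero => exact fun p q _ _ => ⟨q - p, by simp [h0]⟩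
  | succ k ih =>
    intro p q hx hy
    obtain ⟨r, h, hVW⟩ := hF k
    obtain ⟨j, hj⟩ := ih p q (hx.of_isRefinement hVW) (hy.of_isRefinement hVW)
    obtain ⟨w, hw⟩ := hVW.exists_marker
    have hr : (0 : ℤ) < r := by
      exact_mod_cast Nat.pos_of_mul_pos_right (h ▸ (F (k + 1)).len_pos)
    have hn : (0 : ℤ) < (F k).len := by exact_mod_cast (F k).len_pos
    set t : ℤ := |N - p|
    have ht : N ≤ p + (r * t) * (F k).len := by
      have h1 : N - p ≤ t := le_abs_self _
      have h2 : 0 ≤ t := abs_nonneg _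
      have h3 : t ≤ r * t := by nlinarith
      nlinarith
    have hwin : window (F k).len x (p + (r * t) * (F k).len) =
        window (F k).len y (q + (r * t - j) * (F k).len) := by
      funext i
      have : q + (r * t - j) * (F k).len = p + (r * t) * (F k).len := by rw [hj]; ring
      simp only [window, this]
      exact hxy _ (by lia)
    have hx' := (hx.window_eq_marker_iff hw (r * t)).2 (dvd_mul_right _ _)
    rw [hwin, hy.window_eq_marker_iff hw, dvd_sub_right (dvd_mul_right _ _)] at hx'
    obtain ⟨c, rfl⟩ := hx'
    refine ⟨c, ?_⟩
    rw [hj, h]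
    push_cast
    ring

/-- Distinct words of level `k` differ at two positions at distance at least `k`. -/
lemma exists_ne_ne (hF : ∀ k, (F (k + 1)).Refines (F k)) (k : ℕ) :
    ∀ u ∈ (F k).words, ∀ v ∈ (F k).words, u ≠ v →
      ∃ a b : Fin (F k).len, (a : ℕ) + k ≤ b ∧ u a ≠ v a ∧ u b ≠ v b := by
  induction k with
  | zero =>
    intro u _ v _ huv
    obtain ⟨a, ha⟩ := Function.ne_iff.1 huv
    exact ⟨a, a, by simp, ha, ha⟩
  | succ k ih =>
    intro u hu v hv huv
    obtain ⟨r, h, hVW⟩ := hF k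
    obtain ⟨i, j, hij, hi, hj⟩ := hVW.separated u hu v hv huv
    obtain ⟨a, ha⟩ := Function.ne_iff.1 hi
    obtain ⟨b, c, hbc, -, hc⟩ :=
      ih _ (hVW.subblock_mem u hu j) _ (hVW.subblock_mem v hv j) hj
    refine ⟨_, _, ?_, ha, hc⟩
    simp only [Fin.val_cast, finProdFinEquiv_apply_val]
    have h1 : (i : ℕ) + 1 ≤ j := hij
    have h2 := Nat.mul_le_mul_left (F k).len h1
    have h3 := a.2
    rw [mul_add, mul_one] at h2
    lia

theorem eq_of_finite_ne (h0 : (F 0).len = 1) (hF : ∀ k, (F (k + 1)).Refines (F k))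
    (hx : ∀ k, x ∈ (F k).concatSet) (hy : ∀ k, y ∈ (F k).concatSet)
    (hxy : {i | x i ≠ y i}.Finite) : x = y := by
  by_contra H
  obtain ⟨i₀, hi₀⟩ := Function.ne_iff.1 H
  obtain ⟨U, hU⟩ := hxy.bddAbove
  obtain ⟨L, hL⟩ := hxy.bddBelow
  have hLU : L ≤ U := (hL hi₀).trans (hU hi₀)
  set k := (U - L + 1).toNat with hk
  obtain ⟨p, hp⟩ := hx k
  obtain ⟨q, hq⟩ := hy k
  obtain ⟨j, rfl⟩ := exists_eq_add_mul_len h0 hF (N := U + 1)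
    (fun i hi => by
      by_contra hne
      have := hU hne
      lia) k p q hp hq
  have hp' := hp.add_mul j
  set p' := p + j * (F k).len
  have hn : (0 : ℤ) < (F k).len := by exact_mod_cast (F k).len_pos
  set i := (i₀ - p') / (F k).len
  have hne : window (F k).len x (p' + i * (F k).len) ≠ window (F k).len y (p' + i * (F k).len) := by
    intro heq
    have h1 := Int.emod_nonneg (i₀ - p') hn.ne'
    have h2 := Int.emod_lt_of_pos (i₀ - p') hn
    have h3 := Int.mul_ediv_add_emod (i₀ - p') (F k).len
    have := congrFun heq ⟨((i₀ - p') % (F k).len).toNat, by lia⟩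
    simp only [window, Int.toNat_of_nonneg h1] at this
    have h4 : p' + i * (F k).len + (i₀ - p') % (F k).len = i₀ := by
      linear_combination h3
    rw [h4] at this
    exact hi₀ this
  obtain ⟨a, b, hab, ha, hb⟩ := exists_ne_ne hF k _ (hp' i) _ (hq i) hne
  have h1 := hL ha
  have h2 := hU hb
  lia

lemma isClosed_concatSet [TopologicalSpace A] [DiscreteTopology A] (W : BlockFamily A) :
    IsClosed W.concatSet := by
  have hn : (0 : ℤ) < W.len := by exact_mod_cast W.len_pos
  have h1 : W.concatSet = ⋃ p ∈ Finset.Ico (0 : ℤ) W.len, {x | W.IsConcat p x} := by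
    ext x
    simp only [concatSet, mem_ofPred_eq, mem_iUnion, Finset.mem_Ico, exists_prop]
    refine ⟨fun ⟨p, hp⟩ => ⟨p % W.len, ⟨Int.emod_nonneg _ hn.ne', Int.emod_lt_of_pos _ hn⟩, ?_⟩,
      fun ⟨p, _, hp⟩ => ⟨p, hp⟩⟩
    have := hp.add_mul (-(p / W.len))
    have h3 := Int.mul_ediv_add_emod p W.len
    rwa [show p + -(p / W.len) * W.len = p % W.len by linear_combination -h3] at this
  rw [h1]
  refine isClosed_biUnion_finset fun p _ => ?_
  simp only [IsConcat, ofPred_forall]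
  refine isClosed_iInter fun i => ?_
  have hc : Continuous fun x : ℤ → A => window W.len x (p + i * W.len) := by
    unfold window
    fun_prop
  exact (W.words.finite_toSet.isClosed).preimage hc

/-- The words of length `n` occurring at the origin in the elements of `S`. -/
def language (n : ℕ) (S : Set (ℤ → A)) : Set (Fin n → A) := (window n · 0) '' S

lemma two_pow_le_ncard_language_concatSet [Finite A] (W : BlockFamily A) (n : ℕ) :
    2 ^ n ≤ (language n W.concatSet).ncard := by
  classical
  have hn : (0 : ℤ) < W.len := by exact_mod_cast W.len_pos
  have hlt : ∀ i : ℤ, (i % W.len).toNat < W.len := fun i => by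
    have := Int.emod_lt_of_pos i hn
    lia
  obtain ⟨w₀, hw₀⟩ : W.words.Nonempty := Finset.card_pos.1 (by have := W.card_words; lia)
  let g : (Fin n → W.words) → ℤ → W.words := fun f b =>
    if h : 0 ≤ b ∧ b < n then f ⟨b.toNat, by lia⟩ else ⟨w₀, hw₀⟩
  let X : (Fin n → W.words) → ℤ → A := fun f i =>
    (g f (i / W.len) : Fin W.len → A) ⟨(i % W.len).toNat, hlt i⟩
  have hX : ∀ f b, window W.len (X f) (b * W.len) = g f b := by
    intro f b
    funext j
    have hj : ((j : ℕ) : ℤ) < W.len := by exact_mod_cast j.2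
    have h1 : (b * W.len + (j : ℕ) : ℤ) / W.len = b := by
      rw [add_comm, Int.add_mul_ediv_right _ _ hn.ne', Int.ediv_eq_zero_of_lt (by lia) (by lia)]
      simp
    have h2 : (b * W.len + (j : ℕ) : ℤ) % W.len = j := by
      rw [add_comm, Int.add_mul_emod_self_right, Int.emod_eq_of_lt (by lia) (by lia)]
    simp only [window, X]
    simp only [h1, h2, Int.toNat_natCast]
  have hXW : ∀ f, X f ∈ W.concatSet := fun f => ⟨0, fun i => by
    rw [zero_add, hX]
    exact (g f i).2⟩
  let Ψ : (Fin n → W.words) → Fin W.len → language n W.concatSet := fun f j =>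
    ⟨window n (X f) (j * n), _, shift_mem_concatSet (hXW f) (j * n), by
      funext i
      simp [window, add_comm]⟩
  have hΨ : Function.Injective Ψ := by
    intro f f' hff
    have hag : ∀ i : ℤ, 0 ≤ i → i < n * W.len → X f i = X f' i := by
      intro i hi hi'
      have hn' : (0 : ℤ) < n := by
        by_contra h
        nlinarith
      have h1 := Int.emod_nonneg i hn'.ne'
      have h2 := Int.emod_lt_of_pos i hn'
      have h3 := Int.mul_ediv_add_emod i n
      have h4 : 0 ≤ i / n := Int.ediv_nonneg hi hn'.le
      have h5 : i / n < W.len := Int.ediv_lt_of_lt_mul hn' (by rwa [mul_comm])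
      have := congrFun (congrArg Subtype.val (congrFun hff ⟨(i / n).toNat, by lia⟩))
        ⟨(i % n).toNat, by lia⟩
      simp only [Ψ, window, Int.toNat_of_nonneg h1, Int.toNat_of_nonneg h4] at this
      rwa [mul_comm, h3] at this
    funext b
    have hg : ∀ f, g f b = f b := fun f => by simp [g]
    rw [← hg f, ← hg f', ← Subtype.val_inj, ← hX, ← hX]
    funext i
    have hb : ((b : ℕ) : ℤ) + 1 ≤ n := by exact_mod_cast b.2
    have hi : ((i : ℕ) : ℤ) < W.len := by exact_mod_cast i.2
    exact hag _ (by positivity) (by nlinarith)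
  have hcard := Nat.card_le_card_of_injective Ψ hΨ
  rw [Nat.card_fun, Nat.card_fun, Nat.card_coe_set_eq, Nat.card_fin, Nat.card_fin,
    Nat.card_eq_fintype_card, Fintype.card_coe] at hcard
  refine (Nat.pow_le_pow_iff_left W.len_pos.ne').1 (le_trans ?_ hcard)
  have hW := W.card_words
  rw [← pow_mul, mul_comm, pow_mul]
  exact Nat.pow_le_pow_left (by lia) n

/-- The subshift of the sequences which are concatenations of words of each level. -/
def subshift (F : ℕ → BlockFamily A) : Set (ℤ → A) := ⋂ k, (F k).concatSet

lemma two_pow_le_ncard_language_subshift [TopologicalSpace A] [DiscreteTopology A] [Finite A]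
    (hF : ∀ k, (F (k + 1)).Refines (F k)) (n : ℕ) :
    2 ^ n ≤ (language n (subshift F)).ncard := by
  have hanti : Antitone fun k => (F k).concatSet :=
    antitone_nat_of_succ_le fun k => (hF k).concatSet_subset
  have key : ∀ w : Fin n → A, ∃ k, w ∈ language n (F k).concatSet →
      w ∈ language n (subshift F) := by
    intro w
    by_contra! H
    have hclosed : IsClosed {x : ℤ → A | window n x 0 = w} := by
      refine isClosed_eq ?_ continuous_const
      unfold window
      fun_prop
    obtain ⟨x, hx⟩ := IsCompact.nonempty_iInter_of_sequence_nonempty_isCompact_isClosed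
      (fun k => (F k).concatSet ∩ {x | window n x 0 = w})
      (fun k => inter_subset_inter_left _ (hanti k.le_succ))
      (fun k => (H k).1) (((F 0).isClosed_concatSet.inter hclosed).isCompact)
      (fun k => (F k).isClosed_concatSet.inter hclosed)
    rw [mem_iInter] at hx
    exact (H 0).2 ⟨x, mem_iInter.2 fun k => (hx k).1, (hx 0).2⟩
  choose K hK using key
  obtain ⟨k, hk⟩ := (finite_range K).bddAbove
  refine (two_pow_le_ncard_language_concatSet (F k) n).trans (ncard_le_ncard fun w hw => ?_)
  exact hK w (image_mono (hanti (hk ⟨w, rfl⟩)) hw)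

lemma isClosed_subshift [TopologicalSpace A] [DiscreteTopology A] : IsClosed (subshift F) :=
  isClosed_iInter fun k => (F k).isClosed_concatSet

lemma shift_mem_subshift (hx : x ∈ subshift F) (a : ℤ) : (fun i => x (i + a)) ∈ subshift F :=
  mem_iInter.2 fun k => shift_mem_concatSet (mem_iInter.1 hx k) a

/-- The left shift on `subshift F`. -/
def shift [TopologicalSpace A] (F : ℕ → BlockFamily A) : subshift F ≃ₜ subshift F where
  toFun x := ⟨fun i => x.1 (i + 1), shift_mem_subshift x.2 1⟩
  invFun x := ⟨fun i => x.1 (i + -1), shift_mem_subshift x.2 (-1)⟩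
  left_inv x := by simp
  right_inv x := by simp
  continuous_toFun :=
    Continuous.subtype_mk (continuous_pi fun i =>
      (continuous_apply (i + 1)).comp (continuous_subtype_val (p := (· ∈ subshift F)))) _
  continuous_invFun :=
    Continuous.subtype_mk (continuous_pi fun i =>
      (continuous_apply (i + -1)).comp (continuous_subtype_val (p := (· ∈ subshift F)))) _

lemma shift_zpow_apply [TopologicalSpace A] (n : ℤ) (x : subshift F) (i : ℤ) :
    (((shift F).toEquiv ^ n) x).1 i = x.1 (i + n) := by
  induction n generalizing i with
  | zero => simp
  | succ n ih =>
    rw [add_comm, zpow_add, zpow_one, Equiv.Perm.mul_apply, ← add_assoc]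
    exact ih (i + 1)
  | pred n ih =>
    rw [sub_eq_neg_add, zpow_add, zpow_neg_one, Equiv.Perm.mul_apply, ← add_assoc]
    exact ih (i + -1)

lemma shift_iterate_apply [TopologicalSpace A] (n : ℕ) (x : subshift F) (i : ℤ) :
    ((shift F)^[n] x).1 i = x.1 (i + n) := by
  rw [← shift_zpow_apply, zpow_natCast, Equiv.Perm.coe_pow]
  rfl

lemma subshift_nonempty [TopologicalSpace A] [DiscreteTopology A] [Finite A]
    (hF : ∀ k, (F (k + 1)).Refines (F k)) : (subshift F).Nonempty := by
  have h := two_pow_le_ncard_language_subshift hF 0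
  rw [pow_zero] at h
  have h' : (language 0 (subshift F)).Nonempty := nonempty_of_ncard_ne_zero (by lia)
  exact h'.of_image

end BlockFamily

lemma exists_pos_forall_dist_lt_imp_eq {X : Type*} [PseudoMetricSpace X] [CompactSpace X]
    [TopologicalSpace A] [DiscreteTopology A] {f : X → A} (hf : Continuous f) :
    ∃ ε > 0, ∀ x y, dist x y < ε → f x = f y := by
  have hopen : IsOpen {z : X × X | f z.1 = f z.2} :=
    (isOpen_discrete {z : A × A | z.1 = z.2}).preimage (by fun_prop : Continuous (Prod.map f f))
  have hmem : {z : X × X | f z.1 = f z.2} ∈ uniformity X := by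
    rw [← nhdsSet_diagonal_eq_uniformity, hopen.mem_nhdsSet]
    rintro ⟨x, y⟩ (rfl : x = y)
    rfl
  obtain ⟨ε, hε, h⟩ := Metric.mem_uniformity_dist.1 hmem
  exact ⟨ε, hε, fun x y hxy => h hxy⟩

open BlockFamily in
lemma coverEntropy_shift_pos [TopologicalSpace A] [DiscreteTopology A] [Finite A]
    {F : ℕ → BlockFamily A} (hF : ∀ k, (F (k + 1)).Refines (F k)) [UniformSpace (subshift F)]
    (hU : {z : subshift F × subshift F | z.1.1 0 = z.2.1 0} ∈ uniformity (subshift F)) :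
    0 < Dynamics.coverEntropy (shift F) univ := by
  classical
  refine lt_of_lt_of_le ?_ (Dynamics.netEntropyEntourage_le_coverEntropy _ _ hU)
  refine lt_of_lt_of_le (b := ENNReal.log 2) (by simp) ?_
  rw [← ExpGrowth.expGrowthSup_pow, Dynamics.netEntropyEntourage]
  refine ExpGrowth.expGrowthSup_monotone fun n => ?_
  have hex : ∀ w : language n (subshift F), ∃ x : subshift F, window n x.1 0 = w :=
    fun ⟨w, x, hx, hw⟩ => ⟨⟨x, hx⟩, hw⟩
  choose s hs using hex
  have hinj : Function.Injective s := fun v w hvw => by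
    rw [← Subtype.val_inj, ← hs, ← hs, hvw]
  have := Fintype.ofFinite (language n (subshift F))
  have hnet : Dynamics.IsDynNetIn (shift F) univ
      {z : subshift F × subshift F | z.1.1 0 = z.2.1 0} n (Finset.univ.image s : Finset _) := by
    refine ⟨subset_univ _, ?_⟩
    simp only [Finset.coe_image, Finset.coe_univ, image_univ]
    rintro _ ⟨v, rfl⟩ _ ⟨w, rfl⟩ hvw
    refine disjoint_left.2 fun z hv hw => hvw (congrArg s ?_)
    rw [Dynamics.mem_ball_dynEntourage] at hv hw
    rw [← Subtype.val_inj, ← hs, ← hs]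
    funext i
    have h1 : ((shift F)^[i] (s v)).1 0 = ((shift F)^[i] z).1 0 := hv i i.2
    have h2 : ((shift F)^[i] (s w)).1 0 = ((shift F)^[i] z).1 0 := hw i i.2
    simp only [shift_iterate_apply] at h1 h2
    exact h1.trans h2.symm
  have hcard := hnet.card_le_netMaxcard
  rw [Finset.card_image_of_injective _ hinj, Finset.card_univ, ← Nat.card_eq_fintype_card,
    Nat.card_coe_set_eq] at hcard
  have h : ((2 ^ n : ℕ) : ℕ∞) ≤ _ :=
    (Nat.cast_le.2 (two_pow_le_ncard_language_subshift hF n)).trans hcard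
  simpa using ENat.toENNReal_mono h

end BlockSubshift

open BlockSubshift BlockFamily in
theorem exists_expansive_pos_entropy_no_asymptotic :
    Nonempty ExpansivePosEntropyNoAsympWitness := by
  obtain ⟨F, h0, hF⟩ := exists_seq_refines
  let _ : MetricSpace (subshift F) := TopologicalSpace.metrizableSpaceMetric _
  have : CompactSpace (subshift F) := isCompact_iff_compactSpace.1 isClosed_subshift.isCompact
  have hcont : Continuous fun x : subshift F => x.1 0 :=
    (continuous_apply 0).comp continuous_subtype_val
  obtain ⟨ε, hε, hdist⟩ := exists_pos_forall_dist_lt_imp_eq hcont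
  have happly : ∀ (n : ℤ) (x y : subshift F),
      dist (((shift F).toEquiv ^ n) x) (((shift F).toEquiv ^ n) y) < ε → x.1 n = y.1 n := by
    intro n x y hxy
    simpa [shift_zpow_apply] using hdist _ _ hxy
  have hexp : ∀ x y : subshift F, (∀ n : ℤ,
      dist (((shift F).toEquiv ^ n) x) (((shift F).toEquiv ^ n) y) ≤ ε / 2) → x = y :=
    fun x y hxy => Subtype.ext <| funext fun n =>
      happly n x y ((hxy n).trans_lt (half_lt_self hε))
  have hasymp : ∀ x y : subshift F, (∀ δ : ℝ, 0 < δ → {n : ℤ |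
      δ ≤ dist (((shift F).toEquiv ^ n) x) (((shift F).toEquiv ^ n) y)}.Finite) → x = y :=
    fun x y hxy => Subtype.ext <|
      eq_of_finite_ne h0 hF (Set.mem_iInter.1 x.2) (Set.mem_iInter.1 y.2) <|
        (hxy ε hε).subset fun n hn => not_lt.1 fun h => hn (happly n x y h)
  have hent : 0 < Dynamics.coverEntropy (shift F) Set.univ := coverEntropy_shift_pos hF
    (Metric.mem_uniformity_dist.2 ⟨ε, hε, fun {x y} h => hdist x y h⟩)
  exact ⟨⟨subshift F, (subshift_nonempty hF).to_subtype, shift F, ⟨ε / 2, half_pos hε, hexp⟩,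
    hent, hasymp⟩⟩
end

section
/- Let a group Γ act by homeomorphisms on a compact metric space (X,d). Let ε > 0 be such that 2ε is an expansive constant for the action, let S ⊆ Γ be a finite set with S = S⁻¹ and 1 ∈ S, and let δ > 0 be such that every (S,δ) pseudo-orbit is ε-traced by some point of X. Suppose there exist a finite set F ⊆ Γ and points x, x' ∈ X such that d(g·x, g·x') < δ for every g in the S-boundary ∂_S F := {g ∈ Γ : Sg ∩ F ≠ ∅ and Sg ∩ (Γ \ F) ≠ ∅}, while d(g·x, g·x') ≥ 2ε for some g ∈ F. Then there exists y ∈ X with y ≠ x such that (x,y) is an asymptotic pair. -/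
/-- An `(S, δ)` pseudo-orbit for the action of `Γ` on `X`. -/
def IsPseudoOrbit {Γ X : Type*} [Group Γ] [MetricSpace X] [MulAction Γ X]
    (S : Set Γ) (δ : ℝ) (o : Γ → X) : Prop :=
  ∀ s ∈ S, ∀ g : Γ, dist (s • o g) (o (s * g)) < δ

/-- `y` ε-traces the pseudo-orbit `o`. -/
def Traces {Γ X : Type*} [Group Γ] [MetricSpace X] [MulAction Γ X]
    (ε : ℝ) (y : X) (o : Γ → X) : Prop :=
  ∀ g : Γ, dist (g • y) (o g) < ε

/-- `(x, y)` is an asymptotic pair for the action of `Γ` on `X`. -/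
def IsAsymptoticPair (Γ : Type*) {X : Type*} [Group Γ] [MetricSpace X] [MulAction Γ X]
    (x y : X) : Prop :=
  ∀ ε : ℝ, 0 < ε → {g : Γ | ε ≤ dist (g • x) (g • y)}.Finite

/-- Uniform expansivity: finitely many group elements suffice to separate all pairs of points at
distance at least `η`. -/
theorem exists_finset_forall_dist_smul_le_imp_dist_lt {Γ X : Type*} [MetricSpace X]
    [CompactSpace X] [SMul Γ X] [ContinuousConstSMul Γ X] {c : ℝ}
    (hexp : ∀ x y : X, (∀ g : Γ, dist (g • x) (g • y) ≤ c) → x = y) {η : ℝ} (hη : 0 < η) :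
    ∃ K : Finset Γ, ∀ u v : X, (∀ k ∈ K, dist (k • u) (k • v) ≤ c) → dist u v < η := by
  have hcompact : IsCompact {p : X × X | η ≤ dist p.1 p.2} :=
    (isClosed_le continuous_const (continuous_fst.dist continuous_snd)).isCompact
  obtain ⟨K, hK⟩ := hcompact.elim_finite_subfamily_closed
    (fun g : Γ => {p : X × X | dist (g • p.1) (g • p.2) ≤ c})
    (fun g => isClosed_le
      ((continuous_fst.const_smul g).dist (continuous_snd.const_smul g)) continuous_const)
    (by
      refine Set.eq_empty_of_forall_notMem ?_
      rintro ⟨u, v⟩ ⟨huv, hg⟩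
      have h : u = v := hexp u v fun g => Set.mem_iInter.1 hg g
      subst h
      simp only [Set.mem_ofPred_eq, dist_self] at huv
      exact hη.not_ge huv)
  refine ⟨K, fun u v huv => lt_of_not_ge fun hle => ?_⟩
  have hmem : (u, v) ∈ ({p : X × X | η ≤ dist p.1 p.2} ∩
      ⋂ g ∈ K, {p : X × X | dist (g • p.1) (g • p.2) ≤ c}) :=
    ⟨hle, Set.mem_iInter₂.2 huv⟩
  rw [hK] at hmem
  exact hmem

/-- In an expansive action, points whose orbits are within the expansive constant of each other
off a finite set form an asymptotic pair. -/
theorem isAsymptoticPair_of_dist_le_off_finset {Γ X : Type*} [Group Γ] [MetricSpace X]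
    [CompactSpace X] [MulAction Γ X] [ContinuousConstSMul Γ X] {c : ℝ}
    (hexp : ∀ x y : X, (∀ g : Γ, dist (g • x) (g • y) ≤ c) → x = y) {F : Finset Γ} {x y : X}
    (hF : ∀ g ∉ F, dist (g • x) (g • y) ≤ c) : IsAsymptoticPair Γ x y := by
  intro η hη
  obtain ⟨K, hK⟩ := exists_finset_forall_dist_smul_le_imp_dist_lt hexp hη
  refine (Set.Finite.image2 (fun k f => k⁻¹ * f) K.finite_toSet F.finite_toSet).subset ?_
  intro g hg
  by_contra hnot
  refine (hK (g • x) (g • y) fun k hk => ?_).not_ge hg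
  rw [smul_smul, smul_smul]
  exact hF _ fun hkg => hnot ⟨k, hk, k * g, hkg, inv_mul_cancel_left k g⟩

open Classical in
/-- Replacing the orbit of `x` by that of `x'` on `F` gives a pseudo-orbit as soon as the two orbits
are close on the boundary of `F`. -/
theorem isPseudoOrbit_ite {Γ X : Type*} [Group Γ] [MetricSpace X] [MulAction Γ X]
    {S : Finset Γ} (hS1 : (1 : Γ) ∈ S) (hSinv : ∀ s ∈ S, s⁻¹ ∈ S) {δ : ℝ} (hδ : 0 < δ)
    {F : Finset Γ} {x x' : X}
    (hbd : ∀ g : Γ, (∃ s ∈ S, s * g ∈ F) → (∃ s ∈ S, s * g ∉ F) →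
      dist (g • x) (g • x') < δ) :
    IsPseudoOrbit (S : Set Γ) δ fun g : Γ => if g ∈ F then g • x' else g • x := by
  intro s hs g
  by_cases hg : g ∈ F <;> by_cases hsg : s * g ∈ F <;> simp only [hg, hsg, if_true, if_false,
    smul_smul, dist_self, hδ]
  · rw [dist_comm]
    exact hbd _ ⟨s⁻¹, hSinv s hs, by simpa using hg⟩ ⟨1, hS1, by simpa using hsg⟩
  · exact hbd _ ⟨1, hS1, by simpa using hsg⟩ ⟨s⁻¹, hSinv s hs, by simpa using hg⟩

theorem exists_asymptotic_pair_of_traced_boundary_pair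
    {Γ X : Type*} [Group Γ] [MetricSpace X] [CompactSpace X] [MulAction Γ X]
    [ContinuousConstSMul Γ X]
    (ε : ℝ) (hε : 0 < ε)
    (hexp : ∀ x y : X, (∀ g : Γ, dist (g • x) (g • y) ≤ 2 * ε) → x = y)
    (S : Finset Γ) (hS1 : (1 : Γ) ∈ S) (hSinv : ∀ s ∈ S, s⁻¹ ∈ S)
    (δ : ℝ) (hδ : 0 < δ)
    (htrace : ∀ o : Γ → X, IsPseudoOrbit (S : Set Γ) δ o → ∃ y : X, Traces ε y o)
    (F : Finset Γ) (x x' : X)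
    (hbd : ∀ g : Γ, (∃ s ∈ S, s * g ∈ F) → (∃ s ∈ S, s * g ∉ F) →
      dist (g • x) (g • x') < δ)
    (hsep : ∃ g ∈ F, 2 * ε ≤ dist (g • x) (g • x')) :
    ∃ y : X, y ≠ x ∧ IsAsymptoticPair Γ x y := by
  classical
  obtain ⟨y, hy⟩ := htrace _ (isPseudoOrbit_ite hS1 hSinv hδ hbd)
  refine ⟨y, ?_, isAsymptoticPair_of_dist_le_off_finset hexp (F := F) fun g hg => ?_⟩
  · rintro rfl
    obtain ⟨g, hg, hle⟩ := hsep
    have h := hy g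
    simp only [hg, if_true] at h
    linarith
  · have h := hy g
    simp only [hg, if_false] at h
    rw [dist_comm]
    linarith
end

section
/- Let Γ be a countable group and let α be an action of Γ by homeomorphisms on a compact metric space (X,d) that is expansive with expansive constant η and has the pseudo-orbit tracing property. Then for every ε with 0 < 2ε < η there exist a finite set S ⊆ Γ and δ > 0 such that for every action β of Γ on X by homeomorphisms satisfying sup_{x∈X} d(α_s(x), β_s(x)) < δ for all s ∈ S: (a) there exists a continuous map f : X → X with α_g ∘ f = f ∘ β_g for every g ∈ Γ and sup_{x∈X} d(f(x), x) ≤ ε; (b) f is the unique map with these two properties; and (c) if moreover 2ε is an expansive constant for β, then f is injective. -/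
/-- An action of a group `Γ` on a metric space `X` by homeomorphisms. -/
structure ActionByHomeos (Γ X : Type*) [Group Γ] [MetricSpace X] where
  toFun : Γ → X → X
  map_one' : ∀ x : X, toFun 1 x = x
  map_mul' : ∀ (g h : Γ) (x : X), toFun (g * h) x = toFun g (toFun h x)
  continuous' : ∀ g : Γ, Continuous (toFun g)

namespace ActionByHomeos

variable {Γ X : Type*} [Group Γ] [MetricSpace X]

/-- An `(S, δ)` pseudo-orbit for the action `α`. -/
def IsPseudoOrbit (α : ActionByHomeos Γ X) (S : Set Γ) (δ : ℝ) (o : Γ → X) : Prop :=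
  ∀ s ∈ S, ∀ g : Γ, dist (α.toFun s (o g)) (o (s * g)) < δ

/-- `y` ε-traces the pseudo-orbit `o` under the action `α`. -/
def Traces (α : ActionByHomeos Γ X) (ε : ℝ) (y : X) (o : Γ → X) : Prop :=
  ∀ g : Γ, dist (α.toFun g y) (o g) < ε

/-- `c` is an expansive constant for the action `α`. -/
def IsExpansiveConst (α : ActionByHomeos Γ X) (c : ℝ) : Prop :=
  0 < c ∧ ∀ x y : X, (∀ g : Γ, dist (α.toFun g x) (α.toFun g y) ≤ c) → x = y

/-- The pseudo-orbit tracing property for the action `α`. -/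
def POT (α : ActionByHomeos Γ X) : Prop :=
  ∀ ε : ℝ, 0 < ε → ∃ (S : Finset Γ) (δ : ℝ), 0 < δ ∧
    ∀ o : Γ → X, α.IsPseudoOrbit (S : Set Γ) δ o → ∃ y : X, α.Traces ε y o

end ActionByHomeos

/-- A map into a compact space with closed graph is continuous. -/
theorem continuous_of_isClosed_setOf_graph {X Y : Type*} [TopologicalSpace X] [TopologicalSpace Y]
    [CompactSpace Y] {f : X → Y} (hf : IsClosed {p : X × Y | p.2 = f p.1}) : Continuous f := by
  refine continuous_iff_isClosed.2 fun s hs => ?_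
  convert isClosedMap_fst_of_compactSpace _ (hf.inter (hs.preimage continuous_snd)) using 1
  ext x
  simp

namespace ActionByHomeos

variable {Γ X : Type*} [Group Γ] [MetricSpace X]

/-- Two points whose `α`-orbits both `ε`-shadow a common family coincide when `2 * ε` is at most
an expansive constant. -/
theorem IsExpansiveConst.eq_of_shadow {α : ActionByHomeos Γ X} {η ε : ℝ}
    (hη : α.IsExpansiveConst η) (hεη : 2 * ε ≤ η) {o : Γ → X} {y z : X}
    (hy : ∀ g, dist (α.toFun g y) (o g) ≤ ε) (hz : ∀ g, dist (α.toFun g z) (o g) ≤ ε) :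
    y = z := by
  refine hη.2 y z fun g => ?_
  linarith [dist_triangle_right (α.toFun g y) (α.toFun g z) (o g), hy g, hz g]

/-- The pairs `(x, y)` such that the `α`-orbit of `y` `ε`-shadows the `β`-orbit of `x` form a
closed set. -/
theorem isClosed_setOf_shadow (α β : ActionByHomeos Γ X) (ε : ℝ) :
    IsClosed {p : X × X | ∀ g, dist (α.toFun g p.2) (β.toFun g p.1) ≤ ε} := by
  simp only [Set.ofPred_forall]
  exact isClosed_iInter fun g => isClosed_le
    (((α.continuous' g).comp continuous_snd).dist ((β.continuous' g).comp continuous_fst))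
    continuous_const

/-- A map commuting with the actions and `ε`-close to the identity sends `x` to a point whose
`α`-orbit `ε`-shadows the `β`-orbit of `x`. -/
theorem shadow_of_semiconj {α β : ActionByHomeos Γ X} {ε : ℝ} {f : X → X}
    (hf : ∀ g x, α.toFun g (f x) = f (β.toFun g x)) (hε : ∀ x, dist (f x) x ≤ ε) (x : X) (g : Γ) :
    dist (α.toFun g (f x)) (β.toFun g x) ≤ ε := by
  rw [hf]
  exact hε _

end ActionByHomeos

theorem topologically_stable_of_expansive_pot
    {Γ X : Type*} [Group Γ] [Countable Γ] [MetricSpace X] [CompactSpace X]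
    (α : ActionByHomeos Γ X) (η : ℝ) (hη : α.IsExpansiveConst η) (hpot : α.POT)
    (ε : ℝ) (hε : 0 < ε) (hεη : 2 * ε < η) :
    ∃ (S : Finset Γ) (δ : ℝ), 0 < δ ∧
      ∀ β : ActionByHomeos Γ X,
        (∀ s ∈ S, ∀ x : X, dist (α.toFun s x) (β.toFun s x) < δ) →
        ∃ f : X → X,
          (Continuous f ∧ (∀ (g : Γ) (x : X), α.toFun g (f x) = f (β.toFun g x)) ∧
            ∀ x : X, dist (f x) x ≤ ε) ∧
          (∀ f' : X → X, (∀ (g : Γ) (x : X), α.toFun g (f' x) = f' (β.toFun g x)) →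
            (∀ x : X, dist (f' x) x ≤ ε) → f' = f) ∧
          (β.IsExpansiveConst (2 * ε) → Function.Injective f) := by
  obtain ⟨S, δ, hδ, hS⟩ := hpot ε hε
  refine ⟨S, δ, hδ, fun β hβ => ?_⟩
  have htrace (x : X) : ∃ y, α.Traces ε y fun g => β.toFun g x :=
    hS _ fun s hs g => by simpa only [β.map_mul'] using hβ s hs (β.toFun g x)
  choose f hf using htrace
  have hshadow (x : X) (g : Γ) : dist (α.toFun g (f x)) (β.toFun g x) ≤ ε := (hf x g).le
  have huniq {x y : X} (h : ∀ g, dist (α.toFun g y) (β.toFun g x) ≤ ε) : y = f x :=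
    hη.eq_of_shadow hεη.le h (hshadow x)
  refine ⟨f, ⟨?_, fun h x => ?_, fun x => ?_⟩, fun f' hcomm hclose => ?_, fun hβexp x y hxy => ?_⟩
  · refine continuous_of_isClosed_setOf_graph ?_
    convert α.isClosed_setOf_shadow β ε using 1
    ext ⟨x, y⟩
    exact ⟨fun h g => by simpa only [show y = f x from h] using hshadow x g, huniq⟩
  · refine huniq fun g => ?_
    simpa only [α.map_mul', β.map_mul'] using hshadow x (g * h)
  · simpa only [α.map_one', β.map_one'] using hshadow x 1
  · exact funext fun x => huniq (ActionByHomeos.shadow_of_semiconj hcomm hclose x)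
  · refine hβexp.2 x y fun g => ?_
    have hy := hshadow y g
    rw [← hxy] at hy
    linarith [dist_triangle_left (β.toFun g x) (β.toFun g y) (α.toFun g (f x)), hshadow x g]
end

section
/- Let Γ be a group, k ≥ 1, δ ∈ (0, 1/2), and let K, W ⊆ Γ be finite subsets each containing the identity element. Suppose a family (x^{(g)})_{g∈Γ}, where each x^{(g)} : Γ → (ℝ/ℤ)^k, satisfies ρ∞(x^{(g)}(w⁻¹f), x^{(wg)}(f)) < δ for every g ∈ Γ, f ∈ K and w ∈ K⁻¹W = {u⁻¹v : u ∈ K, v ∈ W}. Then there exist functions y^{(g)} : Γ → [−1,1]^k (for each g ∈ Γ) such that y^{(g)}(h) + ℤ^k = x^{(g)}(h) for all g, h ∈ Γ, and ‖y^{(g)}(h⁻¹f) − y^{(hg)}(f)‖∞ < 2δ for every g ∈ Γ, f ∈ K and h ∈ W. -/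
/-- The metric `ρ∞` on `(ℝ/ℤ)^k`:
`ρ∞(v + ℤ^k, w + ℤ^k) = min over representatives of ‖v - w‖∞` (the norm on `Fin k → ℝ` is
the sup-norm). -/
noncomputable def rhoInfty {k : ℕ} (a b : Fin k → AddCircle (1 : ℝ)) : ℝ :=
  sInf {r : ℝ | ∃ v w : Fin k → ℝ,
    (∀ i, ((v i : ℝ) : AddCircle (1 : ℝ)) = a i) ∧
    (∀ i, ((w i : ℝ) : AddCircle (1 : ℝ)) = b i) ∧ r = ‖v - w‖}

theorem AddCircle.exists_coe_eq_abs_eq_norm (d : AddCircle (1 : ℝ)) :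
    ∃ r : ℝ, (r : AddCircle (1 : ℝ)) = d ∧ |r| = ‖d‖ ∧ |r| ≤ 1 / 2 := by
  induction d using QuotientAddGroup.induction_on with
  | H t =>
    refine ⟨t - round t, ?_, ?_, abs_sub_round t⟩
    · have hz : ((round t : ℝ) : AddCircle (1 : ℝ)) = 0 :=
        (AddCircle.coe_eq_zero_iff 1).2 ⟨round t, by simp⟩
      rw [AddCircle.coe_sub, hz, sub_zero]
    · exact UnitAddCircle.norm_eq.symm

theorem norm_sub_lt_of_rhoInfty_lt {k : ℕ} {a b : Fin k → AddCircle (1 : ℝ)} {δ : ℝ}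
    (h : rhoInfty a b < δ) (i : Fin k) : ‖a i - b i‖ < δ := by
  have hne : {r : ℝ | ∃ v w : Fin k → ℝ,
      (∀ i, ((v i : ℝ) : AddCircle (1 : ℝ)) = a i) ∧
      (∀ i, ((w i : ℝ) : AddCircle (1 : ℝ)) = b i) ∧ r = ‖v - w‖}.Nonempty := by
    choose v hv using fun i => AddCircle.exists_coe_eq_abs_eq_norm (a i)
    choose w hw using fun i => AddCircle.exists_coe_eq_abs_eq_norm (b i)
    exact ⟨_, v, w, fun i => (hv i).1, fun i => (hw i).1, rfl⟩
  obtain ⟨_, ⟨v, w, hv, hw, rfl⟩, hlt⟩ := exists_lt_of_csInf_lt hne h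
  rw [← hv i, ← hw i, ← AddCircle.coe_sub]
  refine lt_of_le_of_lt ?_ ((norm_le_pi_norm (v - w) i).trans_lt hlt)
  exact QuotientAddGroup.norm_mk_le_norm

theorem lift_compatible {Γ : Type*} [Group Γ] {k : ℕ} (hk : 1 ≤ k)
    {δ : ℝ} (hδ0 : 0 < δ) (hδ : δ < 1 / 2)
    (K W : Finset Γ) (hK : (1 : Γ) ∈ K) (hW : (1 : Γ) ∈ W)
    (x : Γ → Γ → Fin k → AddCircle (1 : ℝ))
    (hx : ∀ g : Γ, ∀ f ∈ K, ∀ u ∈ K, ∀ v ∈ W,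
      rhoInfty (x g ((u⁻¹ * v)⁻¹ * f)) (x ((u⁻¹ * v) * g) f) < δ) :
    ∃ y : Γ → Γ → Fin k → ℝ,
      (∀ (g h : Γ) (i : Fin k), y g h i ∈ Set.Icc (-1 : ℝ) 1) ∧
      (∀ (g h : Γ) (i : Fin k), ((y g h i : ℝ) : AddCircle (1 : ℝ)) = x g h i) ∧
      (∀ g : Γ, ∀ f ∈ K, ∀ h ∈ W, ‖y g (h⁻¹ * f) - y (h * g) f‖ < 2 * δ) := by
  choose r hr hr_norm hr_half using AddCircle.exists_coe_eq_abs_eq_norm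
  refine ⟨fun g h i => r (x (h⁻¹ * g) 1 i) + r (x g h i - x (h⁻¹ * g) 1 i), ?_, ?_, ?_⟩
  · intro g h i
    have h₁ := abs_le.1 (hr_half (x (h⁻¹ * g) 1 i))
    have h₂ := abs_le.1 (hr_half (x g h i - x (h⁻¹ * g) 1 i))
    constructor <;> linarith [h₁.1, h₁.2, h₂.1, h₂.2]
  · intro g h i
    simp only [AddCircle.coe_add, hr, add_sub_cancel]
  · intro g f hf h hh
    refine (pi_norm_lt_iff (by linarith)).2 fun i => ?_
    have e₁ : (h⁻¹ * f)⁻¹ * g = f⁻¹ * h * g := by group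
    have e₂ : f⁻¹ * (h * g) = f⁻¹ * h * g := by group
    have e₃ : (f⁻¹ * h)⁻¹ * 1 = h⁻¹ * f := by group
    have e₄ : (f⁻¹ * 1)⁻¹ * 1 = f := by group
    have e₅ : f⁻¹ * 1 * (h * g) = f⁻¹ * h * g := by group
    have h₁ := hx g 1 hK f hf h hh
    have h₂ := hx (h * g) 1 hK f hf 1 hW
    rw [e₃] at h₁
    rw [e₄, e₅] at h₂
    have n₁ := norm_sub_lt_of_rhoInfty_lt h₁ i
    have n₂ := norm_sub_lt_of_rhoInfty_lt h₂ i
    rw [← hr_norm, abs_lt] at n₁ n₂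
    simp only [Pi.sub_apply, e₁, e₂, Real.norm_eq_abs, add_sub_add_left_eq_sub]
    rw [abs_lt]
    constructor <;> linarith [n₁.1, n₁.2, n₂.1, n₂.2]
end

section
/- With Γ and X as in the context, let γ = (γ_n)_{n≥1} with γ_n ∈ G_n and γ_n ≠ 1 for all but finitely many n, and let E = {g ∈ Γ : g_n ≠ γ_n for every n ≥ 1}. Then for every function w : E → ℤ/2ℤ there exists x ∈ X such that x(g) = w(g) for every g ∈ E. -/
/-- The restricted direct product of a sequence of groups: the subgroup of `∀ n, G n`
consisting of the sequences that equal `1` in all but finitely many coordinates. -/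
def restrictedProduct (G : ℕ → Type*) [∀ n, Group (G n)] : Subgroup (∀ n, G n) where
  carrier := {g | {n | g n ≠ 1}.Finite}
  one_mem' := by
    have h : {n | (1 : ∀ n, G n) n ≠ 1} = (∅ : Set ℕ) := by
      ext n; simp
    show Set.Finite _
    rw [h]
    exact Set.finite_empty
  mul_mem' := by
    intro a b ha hb
    refine (ha.union hb).subset fun n hn => ?_
    simp only [Set.mem_setOf_eq, Set.mem_union, Pi.mul_apply, ne_eq] at hn ⊢
    by_contra h
    push_neg at h
    exact hn (by rw [h.1, h.2, one_mul])
  inv_mem' := by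
    intro a ha
    refine ha.subset fun n hn => ?_
    simp only [Set.mem_setOf_eq, Pi.inv_apply, ne_eq, inv_eq_one] at hn ⊢
    exact hn

/-- `ι n h` : the element of the restricted product whose `n`-th coordinate is `h` and whose
other coordinates are `1`. -/
def iotaRP (G : ℕ → Type*) [∀ n, Group (G n)] (n : ℕ) (h : G n) : restrictedProduct G :=
  ⟨Pi.mulSingle n h, by
    refine (Set.finite_singleton n).subset fun m hm => ?_
    simp only [Set.mem_setOf_eq, ne_eq] at hm
    rw [Set.mem_singleton_iff]
    by_contra hmn
    exact hm (Pi.mulSingle_eq_of_ne hmn h)⟩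

/-- The elements of the restricted product that avoid `γ` everywhere and agree with `a` at each
coordinate where `a` avoids `γ`. -/
def avoidingCorrections (G : ℕ → Type*) [∀ n, Group (G n)] (γ : ∀ n, G n)
    (a : restrictedProduct G) : Set (restrictedProduct G) :=
  {e | (∀ m, e.1 m ≠ γ m) ∧ ∀ m, a.1 m ≠ γ m → e.1 m = a.1 m}

theorem finite_setOf_restrictedProduct_eq (G : ℕ → Type*) [∀ n, Group (G n)] {γ : ∀ n, G n}
    (hγ : {n | γ n = 1}.Finite) (a : restrictedProduct G) : {n | a.1 n = γ n}.Finite := by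
  refine (hγ.union a.2).subset fun n (hn : a.1 n = γ n) => ?_
  by_cases h : γ n = 1
  · exact Or.inl h
  · exact Or.inr fun h1 => h (hn.symm.trans h1)

theorem finite_avoidingCorrections (G : ℕ → Type*) [∀ n, Group (G n)] [∀ n, Finite (G n)]
    {γ : ∀ n, G n} (hγ : {n | γ n = 1}.Finite) (a : restrictedProduct G) :
    (avoidingCorrections G γ a).Finite := by
  have : Finite {n | a.1 n = γ n} := finite_setOf_restrictedProduct_eq G hγ a
  refine Finite.of_injective (β := ∀ n : {n | a.1 n = γ n}, G n)
    (fun (e : avoidingCorrections G γ a) n => e.1.1 n) fun e e' h => ?_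
  refine Subtype.ext (Subtype.ext (funext fun m => ?_))
  by_cases hm : a.1 m = γ m
  · exact congrFun h ⟨m, hm⟩
  · exact (e.2.2 m hm).trans (e'.2.2 m hm).symm

theorem avoidingCorrections_eq_singleton (G : ℕ → Type*) [∀ n, Group (G n)] {γ : ∀ n, G n}
    {a : restrictedProduct G} (ha : ∀ m, a.1 m ≠ γ m) : avoidingCorrections G γ a = {a} := by
  ext e
  constructor
  · exact fun he => Subtype.ext (funext fun m => he.2 m (ha m))
  · rintro rfl
    exact ⟨ha, fun _ _ => rfl⟩

theorem mul_iotaRP_apply_self (G : ℕ → Type*) [∀ n, Group (G n)] (g : restrictedProduct G) (n : ℕ)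
    (h : G n) : (g * iotaRP G n h).1 n = g.1 n * h := by
  simp [iotaRP]

theorem mul_iotaRP_apply_of_ne (G : ℕ → Type*) [∀ n, Group (G n)] (g : restrictedProduct G)
    {n m : ℕ} (hm : m ≠ n) (h : G n) : (g * iotaRP G n h).1 m = g.1 m := by
  simp [iotaRP, hm]

theorem mem_avoidingCorrections_mul_iotaRP (G : ℕ → Type*) [∀ n, Group (G n)] {γ : ∀ n, G n}
    (g e : restrictedProduct G) (n : ℕ) (h : G n) :
    e ∈ avoidingCorrections G γ (g * iotaRP G n h) ↔
      ((∀ m, e.1 m ≠ γ m) ∧ ∀ m, m ≠ n → g.1 m ≠ γ m → e.1 m = g.1 m) ∧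
        (h = (g.1 n)⁻¹ * γ n ∨ h = (g.1 n)⁻¹ * e.1 n) := by
  rw [eq_inv_mul_iff_mul_eq, eq_inv_mul_iff_mul_eq]
  constructor
  · rintro ⟨he, h1⟩
    refine ⟨⟨he, fun m hm => ?_⟩, ?_⟩
    · simpa only [mul_iotaRP_apply_of_ne G g hm] using h1 m
    · have := h1 n
      rw [mul_iotaRP_apply_self] at this
      exact or_iff_not_imp_left.2 fun hn => (this hn).symm
  · rintro ⟨⟨he, h1⟩, h2⟩
    refine ⟨he, fun m => ?_⟩
    by_cases hm : m = n
    · subst hm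
      rw [mul_iotaRP_apply_self]
      exact fun hn => (h2.resolve_left hn).symm
    · simpa only [mul_iotaRP_apply_of_ne G g hm] using h1 m hm

open Classical in
theorem sum_indicator_avoidingCorrections (G : ℕ → Type*) [∀ n, Group (G n)] {γ : ∀ n, G n}
    (g e : restrictedProduct G) (n : ℕ) [Fintype (G n)] (c : ZMod 2) :
    ∑ h : G n, (if e ∈ avoidingCorrections G γ (g * iotaRP G n h) then c else 0) = 0 := by
  simp only [mem_avoidingCorrections_mul_iotaRP]
  by_cases hP : (∀ m, e.1 m ≠ γ m) ∧ ∀ m, m ≠ n → g.1 m ≠ γ m → e.1 m = g.1 m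
  · have hne : (g.1 n)⁻¹ * γ n ≠ (g.1 n)⁻¹ * e.1 n := fun h => hP.1 n (mul_left_cancel h).symm
    have hfilter : (Finset.univ.filter fun h : G n =>
        h = (g.1 n)⁻¹ * γ n ∨ h = (g.1 n)⁻¹ * e.1 n) = {(g.1 n)⁻¹ * γ n, (g.1 n)⁻¹ * e.1 n} := by
      ext h
      simp
    simp only [and_iff_right hP]
    rw [← Finset.sum_filter, hfilter, Finset.sum_pair hne, CharTwo.add_self_eq_zero]
  · simp only [hP, false_and, if_false, Finset.sum_const_zero]

theorem extension_from_complement_of_shifted_diagonal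
    (G : ℕ → Type*) [∀ n, Group (G n)] [∀ n, Fintype (G n)]
    (X : Set (restrictedProduct G → ZMod 2))
    (hX : X = {x | ∀ (g : restrictedProduct G) (n : ℕ), ∑ h : G n, x (g * iotaRP G n h) = 0})
    (γ : ∀ n, G n) (hγ : {n | γ n = 1}.Finite)
    (E : Set (restrictedProduct G))
    (hE : E = {g : restrictedProduct G | ∀ n : ℕ, (g : ∀ m, G m) n ≠ γ n}) :
    ∀ w : {g : restrictedProduct G // g ∈ E} → ZMod 2,
      ∃ x ∈ X, ∀ g : {g : restrictedProduct G // g ∈ E}, x g = w g := by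
  classical
  subst hX
  intro w
  let W : restrictedProduct G → ZMod 2 := fun e => if he : e ∈ E then w ⟨e, he⟩ else 0
  refine ⟨fun a => ∑ᶠ e, if e ∈ avoidingCorrections G γ a then W e else 0, fun g n => ?_, ?_⟩
  · rw [← finsum_sum_comm]
    · simp only [sum_indicator_avoidingCorrections, finsum_zero]
    · refine fun h _ => (finite_avoidingCorrections G hγ (g * iotaRP G n h)).subset fun e he => ?_
      by_contra hne
      exact he (if_neg hne)
  · rintro ⟨g, hg⟩
    have hg' : ∀ m, g.1 m ≠ γ m := by
      rw [hE] at hg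
      exact hg
    simp only [avoidingCorrections_eq_singleton G hg', Set.mem_singleton_iff]
    rw [finsum_eq_single _ g fun e he => if_neg he, if_pos rfl]
    exact dif_pos hg
end

section
/- With Γ and X as in the context, if x ∈ X and the set {g ∈ Γ : x(g) ≠ 0} is finite, then x(g) = 0 for every g ∈ Γ. Consequently, the shift action of Γ on X (given by (γ·x)(h) = x(γ⁻¹h)) has no off-diagonal asymptotic pairs: any two elements of X that agree outside a finite subset of Γ are equal. -/
/-- A finite set of elements of the restricted product is trivial in some common coordinate. -/
theorem restrictedProduct.exists_forall_mem_eq_one {G : ℕ → Type*} [∀ n, Group (G n)]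
    {S : Set (restrictedProduct G)} (hS : S.Finite) : ∃ n, ∀ g ∈ S, (g : ∀ n, G n) n = 1 := by
  obtain ⟨n, hn⟩ := (hS.biUnion fun g _ => g.2).exists_notMem
  refine ⟨n, fun g hg => ?_⟩
  by_contra h
  exact hn (Set.mem_biUnion hg h)

/-- A finitely supported function on the restricted product whose sums over all cosets of the
factors vanish is zero. -/
theorem restrictedProduct.eq_zero_of_finite_support {G : ℕ → Type*} [∀ n, Group (G n)]
    [∀ n, Fintype (G n)] {A : Type*} [AddCommMonoid A] {x : restrictedProduct G → A}
    (hx : ∀ (g : restrictedProduct G) (n : ℕ), ∑ h : G n, x (g * iotaRP G n h) = 0)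
    (hfin : {g | x g ≠ 0}.Finite) (g : restrictedProduct G) : x g = 0 := by
  by_contra hg
  obtain ⟨n, hn⟩ := restrictedProduct.exists_forall_mem_eq_one hfin
  have hone : iotaRP G n 1 = 1 := Subtype.ext (Pi.mulSingle_one n)
  apply hg
  rw [← hx g n, Finset.sum_eq_single 1, hone, mul_one]
  · intro h _ hh
    by_contra hne
    have key := hn _ hne
    have hgn : (g : ∀ n, G n) n = 1 := hn g hg
    simp only [iotaRP, Subgroup.coe_mul, Pi.mul_apply, hgn, Pi.mulSingle_eq_same, one_mul] at key
    exact hh key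
  · simp

theorem no_offdiagonal_asymptotic_pairs_restricted_product
    (G : ℕ → Type*) [∀ n, Group (G n)] [∀ n, Fintype (G n)]
    (X : Set (restrictedProduct G → ZMod 2))
    (hX : X = {x | ∀ (g : restrictedProduct G) (n : ℕ), ∑ h : G n, x (g * iotaRP G n h) = 0}) :
    -- every finitely supported element of `X` vanishes identically ...
    (∀ x ∈ X, {g : restrictedProduct G | x g ≠ 0}.Finite → ∀ g : restrictedProduct G, x g = 0) ∧
    -- ... and consequently there are no off-diagonal asymptotic pairs:
    -- two elements of `X` agreeing outside a finite set are equal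
    (∀ x ∈ X, ∀ y ∈ X, {g : restrictedProduct G | x g ≠ y g}.Finite → x = y) := by
  subst hX
  refine ⟨fun x hx => restrictedProduct.eq_zero_of_finite_support hx, fun x hx y hy hfin => ?_⟩
  funext g
  refine sub_eq_zero.mp (restrictedProduct.eq_zero_of_finite_support (x := x - y) ?_ ?_ g)
  · intro g n
    simp only [Pi.sub_apply, Finset.sum_sub_distrib, hx g n, hy g n, sub_zero]
  · simpa only [Pi.sub_apply, sub_ne_zero] using hfin
end

section
/- With Γ and X as in the context, assume in addition that each G_n is nontrivial (has at least 2 elements). For n ≥ 1 let Γ̃_n = {g ∈ Γ : g_k = 1 for every k > n}, a finite subgroup of Γ isomorphic to ∏_{k=1}^n G_k. Then the number of distinct restrictions to Γ̃_n of elements of X equals 2^{∏_{k=1}^n (|G_k| − 1)}; that is, the cardinality of the set {x|_{Γ̃_n} : x ∈ X} ⊆ (ℤ/2ℤ)^{Γ̃_n} is 2^{∏_{k=1}^n (|G_k| − 1)}. -/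
theorem coe_mul_iotaRP_self {G : ℕ → Type*} [∀ n, Group (G n)] (g : restrictedProduct G)
    (k : ℕ) (h : G k) : ((g * iotaRP G k h : restrictedProduct G) : ∀ m, G m) k =
      (g : ∀ m, G m) k * h := by
  simp [iotaRP]

theorem coe_mul_iotaRP_of_ne {G : ℕ → Type*} [∀ n, Group (G n)] (g : restrictedProduct G)
    {k m : ℕ} (hmk : m ≠ k) (h : G k) :
    ((g * iotaRP G k h : restrictedProduct G) : ∀ m, G m) m = (g : ∀ m, G m) m := by
  simp [iotaRP, Pi.mulSingle_eq_of_ne hmk]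

theorem mul_iotaRP_one {G : ℕ → Type*} [∀ n, Group (G n)] (g : restrictedProduct G) (k : ℕ) :
    g * iotaRP G k 1 = g := by
  ext m
  simp [iotaRP]

/-- The sum over a coset of a coordinate subgroup of the indicator function of the cube
`∏ k, {1, φ k}` vanishes modulo `2`. -/
theorem sum_indicator_cube_eq_zero {G : ℕ → Type*} [∀ n, Group (G n)] [∀ n, Fintype (G n)]
    (φ : ∀ k, G k) (hφ : ∀ k, φ k ≠ 1) (g : restrictedProduct G) (n : ℕ) :
    ∑ h : G n, {g : restrictedProduct G |
      ∀ k, (g : ∀ m, G m) k = 1 ∨ (g : ∀ m, G m) k = φ k}.indicator (1 : restrictedProduct G → ZMod 2)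
        (g * iotaRP G n h) = 0 := by
  classical
  simp only [Set.indicator_apply, Set.mem_ofPred_eq, Pi.one_apply]
  by_cases hg : ∀ k, k ≠ n → (g : ∀ m, G m) k = 1 ∨ (g : ∀ m, G m) k = φ k
  · have key : ∀ h : G n, (∀ k, ((g * iotaRP G n h : restrictedProduct G) : ∀ m, G m) k = 1 ∨
        ((g * iotaRP G n h : restrictedProduct G) : ∀ m, G m) k = φ k) ↔
        ((g : ∀ m, G m) n * h = 1 ∨ (g : ∀ m, G m) n * h = φ n) := by
      intro h
      rw [← coe_mul_iotaRP_self]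
      refine ⟨fun H => H n, fun H k => ?_⟩
      by_cases hk : k = n
      · subst hk
        exact H
      · rw [coe_mul_iotaRP_of_ne g hk]
        exact hg k hk
    simp only [key]
    rw [(Group.mulLeft_bijective ((g : ∀ m, G m) n)).sum_comp
      (fun h : G n => if h = 1 ∨ h = φ n then (1 : ZMod 2) else 0), Finset.sum_boole]
    have hpair : (Finset.univ.filter fun h : G n => h = 1 ∨ h = φ n) = {1, φ n} := by
      ext h
      simp
    rw [hpair, Finset.card_pair (hφ n).symm]
    decide
  · push Not at hg
    obtain ⟨k, hk, hk1, hk2⟩ := hg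
    refine Finset.sum_eq_zero fun h _ => if_neg fun H => ?_
    have := H k
    rw [coe_mul_iotaRP_of_ne g hk] at this
    exact this.elim hk1 hk2

/-- A function whose sums over all cosets of coordinate subgroups vanish is zero on the elements
supported in the first `n` coordinates as soon as it is zero on those of them that are nontrivial
in each of the first `n` coordinates. -/
theorem eq_zero_of_sum_iotaRP_eq_zero {G : ℕ → Type*} [∀ n, Group (G n)] [∀ n, Fintype (G n)]
    {A : Type*} [AddCommMonoid A] {d : restrictedProduct G → A}
    (hd : ∀ (g : restrictedProduct G) (n : ℕ), ∑ h : G n, d (g * iotaRP G n h) = 0) (n : ℕ)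
    (h₀ : ∀ g : restrictedProduct G, (∀ k, n ≤ k → (g : ∀ m, G m) k = 1) →
      (∀ k < n, (g : ∀ m, G m) k ≠ 1) → d g = 0)
    (g : restrictedProduct G) (hg : ∀ k, n ≤ k → (g : ∀ m, G m) k = 1) : d g = 0 := by
  suffices H : ∀ j ≤ n, ∀ g : restrictedProduct G, (∀ k, n ≤ k → (g : ∀ m, G m) k = 1) →
      (∀ k < n, j ≤ k → (g : ∀ m, G m) k ≠ 1) → d g = 0 from
    H n le_rfl g hg fun k hk hk' => absurd hk hk'.not_gt
  intro j
  induction j with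
  | zero => exact fun _ g hg hg' => h₀ g hg fun k hk => hg' k hk k.zero_le
  | succ j ih =>
    intro hj g hg hg'
    by_cases hgj : (g : ∀ m, G m) j = 1
    · have hsum := hd g j
      rw [Finset.sum_eq_single 1 ?_ (fun h => absurd (Finset.mem_univ _) h),
        mul_iotaRP_one] at hsum
      · exact hsum
      · intro h _ hh
        refine ih (by lia) _ (fun k hk => ?_) fun k hk hjk => ?_
        · rw [coe_mul_iotaRP_of_ne g (by lia)]
          exact hg k hk
        · by_cases hkj : k = j
          · subst hkj
            rwa [coe_mul_iotaRP_self, hgj, one_mul]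
          · rw [coe_mul_iotaRP_of_ne g hkj]
            exact hg' k hk (by lia)
    · refine ih (by lia) g hg fun k hk hjk => ?_
      by_cases hkj : k = j
      · subst hkj
        exact hgj
      · exact hg' k hk (by lia)

/-- The element of the restricted product with prescribed first `n` coordinates, and all other
coordinates equal to `1`. -/
def restrictedProductOfFin (G : ℕ → Type*) [∀ n, Group (G n)] (n : ℕ) (φ : ∀ k : Fin n, G k) :
    restrictedProduct G :=
  ⟨fun k => if hk : k < n then φ ⟨k, hk⟩ else 1, by
    refine (Set.finite_lt_nat n).subset fun k hk => ?_
    by_contra hkn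
    exact hk (dif_neg hkn)⟩

theorem restrictedProductOfFin_apply_of_lt {G : ℕ → Type*} [∀ n, Group (G n)] {n : ℕ}
    (φ : ∀ k : Fin n, G k) {k : ℕ} (hk : k < n) :
    (restrictedProductOfFin G n φ : ∀ m, G m) k = φ ⟨k, hk⟩ :=
  dif_pos hk

theorem restrictedProductOfFin_apply_of_le {G : ℕ → Type*} [∀ n, Group (G n)] {n : ℕ}
    (φ : ∀ k : Fin n, G k) {k : ℕ} (hk : n ≤ k) :
    (restrictedProductOfFin G n φ : ∀ m, G m) k = 1 :=
  dif_neg hk.not_gt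

/-- Functions with vanishing sums over cosets of coordinate subgroups can have arbitrary values
at the elements supported exactly in the first `n` coordinates. -/
theorem exists_sum_iotaRP_eq_zero_and_apply_eq {G : ℕ → Type*} [∀ n, Group (G n)]
    [∀ n, Fintype (G n)] [∀ n, Nontrivial (G n)] (n : ℕ)
    (a : (∀ k : Fin n, {h : G k // h ≠ 1}) → ZMod 2) :
    ∃ x : restrictedProduct G → ZMod 2,
      (∀ (g : restrictedProduct G) (n : ℕ), ∑ h : G n, x (g * iotaRP G n h) = 0) ∧
      ∀ ψ, x (restrictedProductOfFin G n fun k => (ψ k : G k)) = a ψ := by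
  classical
  choose t ht using fun k => exists_ne (1 : G k)
  let ext (φ : ∀ k : Fin n, {h : G k // h ≠ 1}) (k : ℕ) : G k :=
    if hk : k < n then φ ⟨k, hk⟩ else t k
  have hext : ∀ φ k, ext φ k ≠ 1 := by
    intro φ k
    by_cases hk : k < n
    · simpa only [ext, dif_pos hk] using (φ ⟨k, hk⟩).2
    · simpa only [ext, dif_neg hk] using ht k
  refine ⟨fun g => ∑ φ, a φ * {g : restrictedProduct G |
      ∀ k, (g : ∀ m, G m) k = 1 ∨ (g : ∀ m, G m) k = ext φ k}.indicator 1 g,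
    fun g m => ?_, fun ψ => ?_⟩
  · rw [Finset.sum_comm]
    refine Finset.sum_eq_zero fun φ _ => ?_
    rw [← Finset.mul_sum, sum_indicator_cube_eq_zero _ (hext φ), mul_zero]
  · beta_reduce
    rw [Finset.sum_eq_single ψ ?_ (fun h => absurd (Finset.mem_univ _) h)]
    · rw [Set.indicator_of_mem, Pi.one_apply, mul_one]
      intro k
      by_cases hk : k < n
      · right
        rw [restrictedProductOfFin_apply_of_lt _ hk]
        simp only [ext, dif_pos hk]
      · exact Or.inl (restrictedProductOfFin_apply_of_le _ (not_lt.1 hk))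
    · intro φ _ hφ
      rw [Set.indicator_of_notMem, mul_zero]
      refine fun H => hφ (funext fun k => Subtype.ext ?_)
      have := H k
      rw [restrictedProductOfFin_apply_of_lt _ k.2] at this
      simp only [ext, dif_pos k.2] at this
      exact (this.resolve_left (ψ k).2).symm

theorem card_restrictions_to_finite_subgroup
    (G : ℕ → Type*) [∀ n, Group (G n)] [∀ n, Fintype (G n)] [∀ n, Nontrivial (G n)]
    (X : Set (restrictedProduct G → ZMod 2))
    (hX : X = {x | ∀ (g : restrictedProduct G) (n : ℕ), ∑ h : G n, x (g * iotaRP G n h) = 0})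
    (n : ℕ) (hn : 1 ≤ n)
    (Γt : Set (restrictedProduct G))
    (hΓt : Γt = {g : restrictedProduct G | ∀ k : ℕ, n ≤ k → (g : ∀ m, G m) k = 1}) :
    Set.ncard {f : {g : restrictedProduct G // g ∈ Γt} → ZMod 2 |
        ∃ x ∈ X, ∀ g : {g : restrictedProduct G // g ∈ Γt}, f g = x g.1}
      = 2 ^ (∏ k ∈ Finset.range n, (Nat.card (G k) - 1)) := by
  classical
  subst hX hΓt
  let ev : {f : {g : restrictedProduct G //
        g ∈ {g : restrictedProduct G | ∀ k : ℕ, n ≤ k → (g : ∀ m, G m) k = 1}} → ZMod 2 |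
      ∃ x ∈ {x : restrictedProduct G → ZMod 2 |
        ∀ (g : restrictedProduct G) (n : ℕ), ∑ h : G n, x (g * iotaRP G n h) = 0},
        ∀ g, f g = x g.1} → (∀ k : Fin n, {h : G k // h ≠ 1}) → ZMod 2 :=
    fun f ψ => f.1 ⟨restrictedProductOfFin G n fun k => (ψ k : G k),
      fun _ hk => restrictedProductOfFin_apply_of_le _ hk⟩
  have hev : Function.Bijective ev := by
    constructor
    · rintro ⟨f₁, x₁, hx₁, hf₁⟩ ⟨f₂, x₂, hx₂, hf₂⟩ h
      refine Subtype.ext (funext fun g => ?_)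
      show f₁ g = f₂ g
      rw [hf₁, hf₂, ← sub_eq_zero]
      refine eq_zero_of_sum_iotaRP_eq_zero (d := x₁ - x₂) (fun g m => ?_) n
        (fun g hg hg' => ?_) g.1 g.2
      · simp only [Pi.sub_apply, Finset.sum_sub_distrib, hx₁ g m, hx₂ g m, sub_zero]
      · have hψ : restrictedProductOfFin G n (fun k => (g : ∀ m, G m) k) = g := by
          ext k
          by_cases hk : k < n
          · exact restrictedProductOfFin_apply_of_lt _ hk
          · rw [restrictedProductOfFin_apply_of_le _ (not_lt.1 hk), hg k (not_lt.1 hk)]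
        have := congrFun h fun k => ⟨(g : ∀ m, G m) k, hg' k k.2⟩
        simp only [ev, hf₁, hf₂, hψ] at this
        rw [Pi.sub_apply, this, sub_self]
    · intro a
      obtain ⟨x, hx, hxa⟩ := exists_sum_iotaRP_eq_zero_and_apply_eq n a
      exact ⟨⟨fun g => x g.1, x, hx, fun _ => rfl⟩, funext hxa⟩
  have hcard : ∀ k, Nat.card {h : G k // h ≠ 1} = Nat.card (G k) - 1 := fun k => by
    rw [Nat.card_eq_fintype_card, Nat.card_eq_fintype_card, Fintype.card_subtype_compl,
      Fintype.card_subtype_eq]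
  rw [← Nat.card_coe_set_eq, Nat.card_eq_of_bijective ev hev, Nat.card_fun, Nat.card_zmod,
    Nat.card_pi, ← Fin.prod_univ_eq_prod_range (fun k => Nat.card (G k) - 1)]
  simp only [hcard]
end

section
/- Let a : ℕ → ℕ and define b : ℕ → ℕ by b(0) = 1 and b(n) = a(n)·b(n−1) for n ≥ 1. Suppose a(n+1) ≥ 2·b(n) + 3 for every n ≥ 0. Let N : ℕ → ℝ satisfy N(0) = 3 and N(n+1) ≥ 3^{−b(n)}·(N(n) − 1)^{a(n+1)−1} for every n ≥ 0. Then N(n) ≥ 3^{b(n−1)} + 1 for every n ≥ 1. -/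
theorem patterns_nonempty_numerics
    (a b : ℕ → ℕ)
    (hb0 : b 0 = 1)
    (hb : ∀ n : ℕ, 1 ≤ n → b n = a n * b (n - 1))
    (ha : ∀ n : ℕ, 2 * b n + 3 ≤ a (n + 1))
    (N : ℕ → ℝ)
    (hN0 : N 0 = 3)
    (hN : ∀ n : ℕ, ((3 : ℝ) ^ b n)⁻¹ * (N n - 1) ^ (a (n + 1) - 1) ≤ N (n + 1)) :
    ∀ n : ℕ, 1 ≤ n → (3 : ℝ) ^ b (n - 1) + 1 ≤ N n := by
  have hbpos : ∀ n, 1 ≤ b n := by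
    intro n
    induction n with
    | zero => exact hb0.ge
    | succ k ih =>
      rw [hb (k + 1) (by omega), Nat.add_sub_cancel]
      exact Nat.mul_pos (by have := ha k; omega) ih
  intro n hn
  induction n, hn using Nat.le_induction with
  | base =>
    have ha0 := ha 0
    have hN1 := hN 0
    rw [hb0] at ha0
    rw [hb0, hN0] at hN1
    have hpow : (2 : ℝ) ^ 4 ≤ 2 ^ (a (0 + 1) - 1) :=
      pow_le_pow_right₀ (by norm_num) (by omega)
    norm_num [hb0] at hN1 hpow ⊢
    linarith
  | succ k _ ih =>
    rw [Nat.add_sub_cancel]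
    have hthree : (3 : ℝ) ≤ N k - 1 := by
      have : (3 : ℝ) ^ 1 ≤ 3 ^ b (k - 1) :=
        pow_le_pow_right₀ (by norm_num) (hbpos _)
      linarith
    have hpow : (3 : ℝ) ^ (b k + (b k + 2)) ≤ (N k - 1) ^ (a (k + 1) - 1) :=
      calc (3 : ℝ) ^ (b k + (b k + 2)) ≤ 3 ^ (a (k + 1) - 1) :=
            pow_le_pow_right₀ (by norm_num) (by have := ha k; omega)
        _ ≤ (N k - 1) ^ (a (k + 1) - 1) := by gcongr
    have hone : (1 : ℝ) ≤ 3 ^ b k := one_le_pow₀ (by norm_num)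
    calc (3 : ℝ) ^ b k + 1 ≤ 3 ^ (b k + 2) := by rw [pow_add]; linarith
      _ = ((3 : ℝ) ^ b k)⁻¹ * 3 ^ (b k + (b k + 2)) := by
        rw [pow_add 3 (b k) (b k + 2), inv_mul_cancel_left₀ (by positivity)]
      _ ≤ ((3 : ℝ) ^ b k)⁻¹ * (N k - 1) ^ (a (k + 1) - 1) := by gcongr
      _ ≤ N (k + 1) := hN k
end

section
/- Let a : ℕ → ℕ with a(n) ≥ 2 for all n ≥ 1 and define b : ℕ → ℕ by b(0) = 1 and b(n) = a(n)·b(n−1) for n ≥ 1. Let N : ℕ → ℝ satisfy: N(0) = 3; for every n ≥ 1, log N(n) ≥ (a(n) − 1)·log(N(n−1) − 1) − b(n−1)·log 3; and for every n ≥ 1, 3^{b(n−1)} + 1 ≤ N(n) ≤ 3^{b(n)}. Define h(n) = (log N(n))/b(n). Then for every n ≥ 1, h(n) ≥ ((a(1) − 1)/a(1))·log 2 − (1/a(1))·log 3 − Σ_{k=2}^{n} (2/(3^{b(k−2)} + 1) + 2/a(k))·log 3. -/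
theorem one_le_log_three : 1 ≤ Real.log 3 := by
  rw [Real.le_log_iff_exp_le (by norm_num)]
  linarith [Real.exp_one_lt_d9]

/-- Replacing `x` by `x - 1` inside the logarithm costs at most `2 / t` for `2 ≤ t ≤ x`. -/
theorem log_sub_two_div_le_log_sub_one {t x : ℝ} (ht : 2 ≤ t) (hx : t ≤ x) :
    Real.log x - 2 / t ≤ Real.log (x - 1) := by
  have h1 : Real.log (x / (x - 1)) ≤ x / (x - 1) - 1 :=
    Real.log_le_sub_one_of_pos (div_pos (by linarith) (by linarith))
  rw [Real.log_div (by linarith) (by linarith)] at h1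
  have h2 : x / (x - 1) - 1 ≤ 2 / t := by
    have h3 : x / (x - 1) - 1 = 1 / (x - 1) := by
      have : x - 1 ≠ 0 := by linarith
      field_simp
      ring
    rw [h3, div_le_div_iff₀ (by linarith) (by linarith)]
    linarith
  linarith

/-- One step of the recursion for the normalised logarithms `log N / b`. -/
theorem div_sub_le_div_mul {A B L L' l c e : ℝ} (hA : 1 ≤ A) (hB : 1 ≤ B) (hc : 1 ≤ c)
    (he : 0 ≤ e) (hl : L - e ≤ l) (hL : L ≤ B * c) (hL' : (A - 1) * l - B * c ≤ L') :
    L / B - (e + 2 / A) * c ≤ L' / (A * B) := by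
  have hA0 : 0 < A := by linarith
  have hB0 : 0 < B := by linarith
  rw [le_div_iff₀ (mul_pos hA0 hB0)]
  have h1 : (L / B - (e + 2 / A) * c) * (A * B) = A * L - (e * (A * B) + 2 * B) * c := by
    field_simp
  rw [h1]
  have h2 : (A - 1) * (L - e) ≤ (A - 1) * l :=
    mul_le_mul_of_nonneg_left hl (by linarith)
  have h3 : (A - 1) * e ≤ A * B * c * e := by
    refine mul_le_mul_of_nonneg_right ?_ he
    have h4 : A ≤ A * B := le_mul_of_one_le_right hA0.le hB
    have h5 : A * B ≤ A * B * c := le_mul_of_one_le_right (by positivity) hc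
    linarith
  nlinarith

theorem entropy_lower_bound_numerics
    (a b : ℕ → ℕ)
    (ha2 : ∀ n : ℕ, 1 ≤ n → 2 ≤ a n)
    (hb0 : b 0 = 1)
    (hb : ∀ n : ℕ, 1 ≤ n → b n = a n * b (n - 1))
    (N : ℕ → ℝ)
    (hN0 : N 0 = 3)
    (hNlog : ∀ n : ℕ, 1 ≤ n →
      ((a n : ℝ) - 1) * Real.log (N (n - 1) - 1) - (b (n - 1) : ℝ) * Real.log 3
        ≤ Real.log (N n))
    (hNlb : ∀ n : ℕ, 1 ≤ n → (3 : ℝ) ^ b (n - 1) + 1 ≤ N n)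
    (hNub : ∀ n : ℕ, 1 ≤ n → N n ≤ (3 : ℝ) ^ b n)
    (h : ℕ → ℝ)
    (hh : ∀ n : ℕ, h n = Real.log (N n) / (b n : ℝ)) :
    ∀ n : ℕ, 1 ≤ n →
      ((a 1 : ℝ) - 1) / (a 1 : ℝ) * Real.log 2 - (1 / (a 1 : ℝ)) * Real.log 3
        - (∑ k ∈ Finset.Icc 2 n,
            (2 / ((3 : ℝ) ^ b (k - 2) + 1) + 2 / (a k : ℝ)) * Real.log 3)
        ≤ h n := by
  have hbpos : ∀ n, 1 ≤ b n := by
    intro n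
    induction n with
    | zero => exact hb0.ge
    | succ k ih =>
      rw [hb (k + 1) (by omega)]
      exact Nat.mul_pos (by have := ha2 (k + 1) (by omega); omega) ih
  intro n hn
  induction n, hn using Nat.le_induction with
  | base =>
    have h1 := hNlog 1 le_rfl
    have hA : (0 : ℝ) < a 1 := by exact_mod_cast (ha2 1 le_rfl).trans_lt' two_pos
    have hb1 : b 1 = a 1 := by simp [hb 1 le_rfl, hb0]
    norm_num [hN0, hb0] at h1
    rw [hh, hb1, le_div_iff₀ hA]
    simp only [Finset.Icc_eq_empty_of_lt one_lt_two, Finset.sum_empty]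
    field_simp
    linarith
  | succ n hn ih =>
    rw [Finset.sum_Icc_succ_top (by omega)]
    have hA : (1 : ℝ) ≤ a (n + 1) := by
      exact_mod_cast one_le_two.trans (ha2 (n + 1) (by omega))
    have hB : (1 : ℝ) ≤ b n := by exact_mod_cast hbpos n
    have hT : (2 : ℝ) ≤ (3 : ℝ) ^ b (n - 1) + 1 := by
      linarith [one_le_pow₀ (by norm_num : (1 : ℝ) ≤ 3) (n := b (n - 1))]
    have hlb := hNlb n hn
    have hL : Real.log (N n) ≤ b n * Real.log 3 := by
      rw [← Real.log_pow]
      exact Real.log_le_log (by linarith) (hNub n hn)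
    have hstep := div_sub_le_div_mul hA hB one_le_log_three
      (div_nonneg zero_le_two (by linarith)) (log_sub_two_div_le_log_sub_one hT hlb) hL
      (hNlog (n + 1) (by omega))
    have hbn : (b (n + 1) : ℝ) = a (n + 1) * b n := by
      exact_mod_cast hb (n + 1) (by omega)
    rw [← hbn, ← hh, ← hh] at hstep
    rw [show n + 1 - 2 = n - 1 by omega]
    linarith
end

section
/- With the setup of the context, for every n ≥ 0 one has R_{n+1} ⊆ R_n. -/
/-- The combinatorial setup of Section 5: a chain of finite-index normal subgroups
`Γs n` of `Γ` with `Γs 0 = Γ`, transversals `T n` of `Γs n` in `Γs (n-1)`, the fundamental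
domains `E n = T n · E (n-1)` (with `E 0 = {1}`), and inductively chosen pattern sets
`A n ⊆ (ℤ/3ℤ)^{E n}` with distinguished patterns `w n ∈ A n` and sum-patterns `s n`,
such that every `v ∈ A n` restricts to `w (n-1)` on `E (n-1)`, its translate by every
`t ∈ T n \ {1}` lies in `A (n-1) \ {w (n-1)}`, and the sum of all its `T n`-translates
equals `s (n-1)`. -/
structure SubshiftSetup (Γ : Type*) [Group Γ] where
  Γs : ℕ → Subgroup Γ
  Γs_zero : Γs 0 = ⊤
  Γs_antitone : ∀ n : ℕ, Γs (n + 1) ≤ Γs n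
  Γs_normal : ∀ n : ℕ, (Γs n).Normal
  Γs_finiteIndex : ∀ n : ℕ, (Γs n).FiniteIndex
  T : ℕ → Finset Γ
  one_mem_T : ∀ n : ℕ, 1 ≤ n → (1 : Γ) ∈ T n
  T_subset : ∀ n : ℕ, 1 ≤ n → ∀ t ∈ T n, t ∈ Γs (n - 1)
  T_coset : ∀ n : ℕ, 1 ≤ n → ∀ g ∈ Γs (n - 1), ∃! t : Γ, t ∈ T n ∧ g * t⁻¹ ∈ Γs n
  E : ℕ → Finset Γ
  E_zero : E 0 = {1}
  E_succ : ∀ n : ℕ, 1 ≤ n → ∀ g : Γ, g ∈ E n ↔ ∃ t ∈ T n, ∃ e ∈ E (n - 1), g = t * e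
  mul_mem_E : ∀ n : ℕ, 1 ≤ n → ∀ t ∈ T n, ∀ f ∈ E (n - 1), t * f ∈ E n
  A : (n : ℕ) → Set ({x : Γ // x ∈ E n} → ZMod 3)
  w : (n : ℕ) → {x : Γ // x ∈ E n} → ZMod 3
  s : (n : ℕ) → {x : Γ // x ∈ E n} → ZMod 3
  w_mem_A : ∀ n : ℕ, w n ∈ A n
  A_zero : A 0 = Set.univ
  A_restrict : ∀ (n : ℕ) (hn : 1 ≤ n), ∀ v ∈ A n,
    (fun f : {x : Γ // x ∈ E (n - 1)} =>
      v ⟨(1 : Γ) * f.1, mul_mem_E n hn 1 (one_mem_T n hn) f.1 f.2⟩) = w (n - 1)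
  A_translate : ∀ (n : ℕ) (hn : 1 ≤ n), ∀ v ∈ A n, ∀ (t : Γ) (ht : t ∈ T n), t ≠ 1 →
    (fun f : {x : Γ // x ∈ E (n - 1)} =>
      v ⟨t * f.1, mul_mem_E n hn t ht f.1 f.2⟩) ∈ A (n - 1) ∧
    (fun f : {x : Γ // x ∈ E (n - 1)} =>
      v ⟨t * f.1, mul_mem_E n hn t ht f.1 f.2⟩) ≠ w (n - 1)
  A_sum : ∀ (n : ℕ) (hn : 1 ≤ n), ∀ v ∈ A n, ∀ f : {x : Γ // x ∈ E (n - 1)},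
    ∑ t ∈ (T n).attach, v ⟨t.1 * f.1, mul_mem_E n hn t.1 t.2 f.1 f.2⟩ = s (n - 1) f

variable {Γ : Type*} [Group Γ]

/-- The set `R n`: points `x : Γ → ℤ/3ℤ` such that for every `g ∈ Γs n` the pattern
`f ↦ x (g * f)` on `E n` belongs to `A n`. -/
def SubshiftSetup.R (S : SubshiftSetup Γ) (n : ℕ) : Set (Γ → ZMod 3) :=
  {x | ∀ g ∈ S.Γs n, (fun f : {y : Γ // y ∈ S.E n} => x (g * f.1)) ∈ S.A n}

/-- The set `X n`: points `x` such that `h ↦ x (g * h)` belongs to `R n` for some `g ∈ E n`. -/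
def SubshiftSetup.Xn (S : SubshiftSetup Γ) (n : ℕ) : Set (Γ → ZMod 3) :=
  {x | ∃ g ∈ S.E n, (fun h : Γ => x (g * h)) ∈ S.R n}

theorem R_succ_subset_R (S : SubshiftSetup Γ) (n : ℕ) : S.R (n + 1) ⊆ S.R n := by
  intro x hx g hg
  obtain ⟨t, ⟨ht, hgt⟩, -⟩ := S.T_coset (n + 1) (Nat.le_add_left 1 n) g hg
  have hA := hx (g * t⁻¹) hgt
  have key : (fun f : {y : Γ // y ∈ S.E n} => x (g * f.1)) =
      fun f => x (g * t⁻¹ * (t * f.1)) := by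
    funext f
    congr 1
    group
  rw [key]
  by_cases h1 : t = 1
  · subst h1
    have h := S.A_restrict (n + 1) (Nat.le_add_left 1 n) _ hA
    exact h.symm ▸ S.w_mem_A n
  · exact (S.A_translate (n + 1) (Nat.le_add_left 1 n) _ hA t ht h1).1
end

section
/- With the setup of the context, for every n ≥ 1, every x ∈ R_n and every g ∈ Γ: the pattern (f ↦ x(g·f)) on E_n belongs to A_n if and only if g ∈ Γ_n. -/
variable {Γ : Type*} [Group Γ]

namespace SubshiftSetup

/-- Every element of `Γs n` is a product of an element of `Γs (n + 1)` and one of `T (n + 1)`. -/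
lemma exists_mul_eq_of_mem_Γs (S : SubshiftSetup Γ) {n : ℕ} {g : Γ} (hg : g ∈ S.Γs n) :
    ∃ γ ∈ S.Γs (n + 1), ∃ t ∈ S.T (n + 1), γ * t = g := by
  obtain ⟨t, ⟨ht, hgt⟩, -⟩ := S.T_coset (n + 1) n.succ_pos g hg
  exact ⟨g * t⁻¹, hgt, t, ht, inv_mul_cancel_right g t⟩

/-- A pattern of `x` lying in `A (n + 1)` restricts to `w n` on `E n`. -/
lemma pattern_eq_w (S : SubshiftSetup Γ) {n : ℕ} {x : Γ → ZMod 3} {g : Γ}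
    (hg : (fun f : {y : Γ // y ∈ S.E (n + 1)} => x (g * f.1)) ∈ S.A (n + 1)) :
    (fun f : {y : Γ // y ∈ S.E n} => x (g * f.1)) = S.w n := by
  have h := S.A_restrict (n + 1) n.succ_pos _ hg
  simp only [one_mul] at h
  exact h

/-- If the pattern of `x` at `g` lies in `A (n + 1)`, then its pattern at `g * t`, for
`t ∈ T (n + 1)` nontrivial, lies in `A n` and differs from `w n`. -/
lemma pattern_mul_mem_A_and_ne_w (S : SubshiftSetup Γ) {n : ℕ} {x : Γ → ZMod 3} {g t : Γ}
    (hg : (fun f : {y : Γ // y ∈ S.E (n + 1)} => x (g * f.1)) ∈ S.A (n + 1))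
    (ht : t ∈ S.T (n + 1)) (ht1 : t ≠ 1) :
    (fun f : {y : Γ // y ∈ S.E n} => x (g * t * f.1)) ∈ S.A n ∧
      (fun f : {y : Γ // y ∈ S.E n} => x (g * t * f.1)) ≠ S.w n := by
  simp only [mul_assoc]
  exact S.A_translate (n + 1) n.succ_pos _ hg t ht ht1

lemma R_succ_subset (S : SubshiftSetup Γ) (n : ℕ) : S.R (n + 1) ⊆ S.R n := by
  intro x hx g hg
  obtain ⟨γ, hγ, t, ht, rfl⟩ := S.exists_mul_eq_of_mem_Γs hg
  by_cases ht1 : t = 1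
  · rw [ht1, mul_one, S.pattern_eq_w (hx γ hγ)]
    exact S.w_mem_A n
  · exact (S.pattern_mul_mem_A_and_ne_w (hx γ hγ) ht ht1).1

lemma mem_Γs_of_pattern_mem_A (S : SubshiftSetup Γ) {n : ℕ} {x : Γ → ZMod 3} (hx : x ∈ S.R n)
    {g : Γ} (hg : (fun f : {y : Γ // y ∈ S.E n} => x (g * f.1)) ∈ S.A n) : g ∈ S.Γs n := by
  induction n with
  | zero => simp [S.Γs_zero]
  | succ n ih =>
    have hw := S.pattern_eq_w hg
    have hgn : g ∈ S.Γs n := ih (S.R_succ_subset n hx) (hw ▸ S.w_mem_A n)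
    obtain ⟨γ, hγ, t, ht, rfl⟩ := S.exists_mul_eq_of_mem_Γs hgn
    by_cases ht1 : t = 1
    · rwa [ht1, mul_one]
    · exact absurd hw (S.pattern_mul_mem_A_and_ne_w (hx γ hγ) ht ht1).2

end SubshiftSetup

theorem pattern_mem_A_iff_mem_Gamma (S : SubshiftSetup Γ) (n : ℕ) (hn : 1 ≤ n)
    (x : Γ → ZMod 3) (hx : x ∈ S.R n) (g : Γ) :
    (fun f : {y : Γ // y ∈ S.E n} => x (g * f.1)) ∈ S.A n ↔ g ∈ S.Γs n :=
  ⟨S.mem_Γs_of_pattern_mem_A hx, hx g⟩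
end

section
/- With the setup of the context, fix n ≥ 0 and suppose Γ_{n+1} is infinite. Let x, y ∈ X_{n+1} and let F ⊆ Γ be a finite set such that x(g) = y(g) for every g ∈ Γ \ F, and such that g₁Γ_n ≠ g₂Γ_n for every pair of distinct elements g₁, g₂ ∈ F. Then x = y. -/
variable {Γ : Type*} [Group Γ]

namespace SubshiftSetup

lemma exists_mul_of_mem (S : SubshiftSetup Γ) {n : ℕ} {k : Γ} (hk : k ∈ S.Γs n) :
    ∃ h ∈ S.Γs (n + 1), ∃ t ∈ S.T (n + 1), k = h * t := by
  obtain ⟨t, ⟨ht, hkt⟩, -⟩ := S.T_coset (n + 1) n.succ_pos k hk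
  exact ⟨k * t⁻¹, hkt, t, ht, by group⟩

lemma exists_mul_mem_E (S : SubshiftSetup Γ) (n : ℕ) (k : Γ) :
    ∃ h ∈ S.Γs n, ∃ f ∈ S.E n, k = h * f := by
  induction n with
  | zero => exact ⟨k, by simp [S.Γs_zero], 1, by simp [S.E_zero], by simp⟩
  | succ n ih =>
    obtain ⟨l, hl, f, hf, rfl⟩ := ih
    obtain ⟨h, hh, t, ht, rfl⟩ := S.exists_mul_of_mem hl
    exact ⟨h, hh, t * f, S.mul_mem_E (n + 1) n.succ_pos t ht f hf, mul_assoc _ _ _⟩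

lemma R_apply_mul_of_mem (S : SubshiftSetup Γ) {n : ℕ} {z : Γ → ZMod 3} (hz : z ∈ S.R (n + 1))
    {h : Γ} (hh : h ∈ S.Γs (n + 1)) (f : {y : Γ // y ∈ S.E n}) : z (h * f.1) = S.w n f := by
  have := congrFun (S.A_restrict (n + 1) n.succ_pos _ (hz h hh)) f
  simp only [one_mul] at this
  exact this

lemma R_translate (S : SubshiftSetup Γ) {n : ℕ} {z : Γ → ZMod 3} (hz : z ∈ S.R (n + 1))
    {h t : Γ} (hh : h ∈ S.Γs (n + 1)) (ht : t ∈ S.T (n + 1)) (ht1 : t ≠ 1) :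
    (fun f : {y : Γ // y ∈ S.E n} => z (h * t * f.1)) ∈ S.A n ∧
      (fun f : {y : Γ // y ∈ S.E n} => z (h * t * f.1)) ≠ S.w n := by
  have := S.A_translate (n + 1) n.succ_pos _ (hz h hh) t ht ht1
  simp only [← mul_assoc] at this
  exact this

lemma R_sum (S : SubshiftSetup Γ) {n : ℕ} {z : Γ → ZMod 3} (hz : z ∈ S.R (n + 1))
    {h : Γ} (hh : h ∈ S.Γs (n + 1)) (f : {y : Γ // y ∈ S.E n}) :
    ∑ t ∈ S.T (n + 1), z (h * (t * f.1)) = S.s n f := by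
  rw [← Finset.sum_attach]
  exact S.A_sum (n + 1) n.succ_pos _ (hz h hh) f

lemma mem_of_pattern_eq_w (S : SubshiftSetup Γ) {n : ℕ} {z : Γ → ZMod 3} (hz : z ∈ S.R (n + 1))
    {k : Γ} (hk : k ∈ S.Γs n) (hw : ∀ f : {y : Γ // y ∈ S.E n}, z (k * f.1) = S.w n f) :
    k ∈ S.Γs (n + 1) := by
  obtain ⟨h, hh, t, ht, rfl⟩ := S.exists_mul_of_mem hk
  by_cases ht1 : t = 1
  · simpa [ht1] using hh
  · exact absurd (funext hw) (S.R_translate hz hh ht ht1).2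

lemma R_mul_left (S : SubshiftSetup Γ) {n : ℕ} {z : Γ → ZMod 3} (hz : z ∈ S.R n)
    {h : Γ} (hh : h ∈ S.Γs n) : (fun k => z (h * k)) ∈ S.R n := by
  intro k hk
  simpa only [mul_assoc] using hz (h * k) (mul_mem hh hk)

/-- The coset of `S.Γs n` at which a point of `S.Xn n` is based is unchanged by
modifying the point at finitely many places. -/
lemma inv_mul_mem_of_agree (S : SubshiftSetup Γ) {n : ℕ} (hinf : (S.Γs n : Set Γ).Infinite)
    {x y : Γ → ZMod 3} {a b : Γ} (hx : (fun h => x (a * h)) ∈ S.R n)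
    (hy : (fun h => y (b * h)) ∈ S.R n) (F : Finset Γ) (hagree : ∀ g : Γ, g ∉ F → x g = y g) :
    b⁻¹ * a ∈ S.Γs n := by
  classical
  induction n with
  | zero => simp [S.Γs_zero]
  | succ n ih =>
    have hn := ih (hinf.mono (S.Γs_antitone n)) (S.R_succ_subset n hx) (S.R_succ_subset n hy)
    obtain ⟨h, hh, hF⟩ := hinf.exists_notMem_finset
      ((F ×ˢ S.E n).image fun p => a⁻¹ * p.1 * p.2⁻¹)
    have hmem : b⁻¹ * a * h ∈ S.Γs (n + 1) := by
      refine S.mem_of_pattern_eq_w hy (mul_mem hn (S.Γs_antitone n hh)) fun f => ?_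
      rw [← S.R_apply_mul_of_mem hx hh f, hagree]
      · congr 1; group
      · intro hf
        exact hF (Finset.mem_image.2 ⟨(a * (h * f.1), f.1),
          Finset.mem_product.2 ⟨hf, f.2⟩, by group⟩)
    exact (Subgroup.mul_mem_cancel_right _ hh).1 hmem

/-- Points of `S.R (n + 1)` are determined by their values off a set which meets
every coset of `S.Γs n` at most once. -/
lemma R_eq_of_agree (S : SubshiftSetup Γ) {n : ℕ} {x y : Γ → ZMod 3} (hx : x ∈ S.R (n + 1))
    (hy : y ∈ S.R (n + 1)) (hsep : ∀ g₁ g₂, x g₁ ≠ y g₁ → x g₂ ≠ y g₂ →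
      g₁⁻¹ * g₂ ∈ S.Γs n → g₁ = g₂) : x = y := by
  funext k
  by_contra hk
  obtain ⟨l, hl, f, hf, rfl⟩ := S.exists_mul_mem_E n k
  obtain ⟨h, hh, t, ht, rfl⟩ := S.exists_mul_of_mem hl
  have hsum := (S.R_sum hx hh ⟨f, hf⟩).trans (S.R_sum hy hh ⟨f, hf⟩).symm
  rw [← sub_eq_zero, ← Finset.sum_sub_distrib, Finset.sum_eq_single_of_mem t ht,
    sub_eq_zero, ← mul_assoc] at hsum
  · exact hk hsum
  · intro u hu hut
    by_contra hne
    rw [sub_eq_zero, ← mul_assoc] at hne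
    refine hut ?_
    have hmem := (S.Γs_normal n).conj_mem _ (mul_mem (inv_mem (S.T_subset (n + 1) n.succ_pos u hu))
      (S.T_subset (n + 1) n.succ_pos t ht)) f⁻¹
    have := hsep _ _ hne hk (by convert hmem using 1; group)
    simpa using this

end SubshiftSetup

theorem eq_of_agree_off_coset_separated_finite_set (S : SubshiftSetup Γ) (n : ℕ)
    (hinf : ((S.Γs (n + 1) : Set Γ)).Infinite)
    (x y : Γ → ZMod 3) (hx : x ∈ S.Xn (n + 1)) (hy : y ∈ S.Xn (n + 1))
    (F : Finset Γ)
    (hagree : ∀ g : Γ, g ∉ F → x g = y g)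
    (hsep : ∀ g₁ ∈ F, ∀ g₂ ∈ F, g₁⁻¹ * g₂ ∈ S.Γs n → g₁ = g₂) :
    x = y := by
  obtain ⟨a, -, hx⟩ := hx
  obtain ⟨b, -, hy⟩ := hy
  have hba := S.inv_mul_mem_of_agree hinf hx hy F hagree
  have hy' : (fun h => y (a * h)) ∈ S.R (n + 1) := by
    simpa [mul_assoc] using S.R_mul_left hy hba
  have hF : ∀ g, x (a * g) ≠ y (a * g) → a * g ∈ F := fun g hg => by
    by_contra h
    exact hg (hagree _ h)
  have heq := S.R_eq_of_agree hx hy' fun g₁ g₂ h₁ h₂ h => mul_left_cancel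
    (hsep _ (hF g₁ h₁) _ (hF g₂ h₂) (by convert h using 1; group))
  funext k
  simpa using congrFun heq (a⁻¹ * k)
end
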